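/- arXiv:1912.06635 — 12 statements merged into one kernel-verified Lean document; each statement's English description precedes it below -/
import Mathlib

section
/- Let a, b > 0 be real numbers and r ∈ ℝ. Define f : ℝ → ℝ by f(η) = −r·η + a·(exp(−η) − 1) + b·(exp(η) − 1). Then f attains its global minimum over ℝ at the unique point η* = (1/2)·log(a/b) + arsinh(r/(2·√(a·b))), and the infimum of f over ℝ equals −( (r/2)·log(a/b) + r·arsinh(r/(2·√(a·b))) − √(4·a·b + r²) + a + b ). -/
theorem mul_exp_half_log_div {a b : ℝ} (ha : 0 < a) (hb : 0 < b) :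
    b * Real.exp ((1 / 2) * Real.log (a / b)) = √(a * b) := by
  have h : (1 / 2) * Real.log (a / b) = Real.log √(a / b) := by
    rw [Real.log_sqrt (by positivity)]; ring
  rw [h, Real.exp_log (by positivity)]
  symm
  rw [Real.sqrt_eq_iff_mul_self_eq (by positivity) (by positivity)]
  have h2 : √(a / b) * √(a / b) = a / b := Real.mul_self_sqrt (by positivity)
  rw [mul_mul_mul_comm, h2]
  field_simp

theorem mul_exp_neg_half_log_div {a b : ℝ} (ha : 0 < a) (hb : 0 < b) :
    a * Real.exp (-((1 / 2) * Real.log (a / b))) = √(a * b) := by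
  have h : -((1 / 2) * Real.log (a / b)) = (1 / 2) * Real.log (b / a) := by
    rw [← inv_div b a, Real.log_inv]; ring
  rw [h, mul_exp_half_log_div hb ha, mul_comm]

/-- Pointwise minimization underlying the explicit form of the Donsker–Varadhan rate
function of the zig-zag process (Lemma 5.3 of the paper): the function
`f η = -r·η + a·(exp(-η) - 1) + b·(exp η - 1)` attains its global minimum at the unique
point `η* = (1/2)·log(a/b) + arsinh(r/(2√(ab)))`, and its infimum equals
`-((r/2)·log(a/b) + r·arsinh(r/(2√(ab))) - √(4ab + r²) + a + b)`. -/
theorem zigzag_pointwise_minimization (a b r : ℝ) (ha : 0 < a) (hb : 0 < b)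
    (f : ℝ → ℝ)
    (hf : ∀ η, f η = -r * η + a * (Real.exp (-η) - 1) + b * (Real.exp η - 1))
    (ηs : ℝ)
    (hηs : ηs = (1 / 2) * Real.log (a / b) + Real.arsinh (r / (2 * Real.sqrt (a * b)))) :
    (∀ η : ℝ, η ≠ ηs → f ηs < f η) ∧
      (⨅ η : ℝ, f η) =
        -((r / 2) * Real.log (a / b) + r * Real.arsinh (r / (2 * Real.sqrt (a * b)))
            - Real.sqrt (4 * a * b + r ^ 2) + a + b) := by
  have hs : 0 < √(a * b) := by positivity
  have hexp : b * Real.exp ηs = √(a * b) * Real.exp (Real.arsinh (r / (2 * √(a * b)))) := by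
    rw [hηs, Real.exp_add, ← mul_assoc, mul_exp_half_log_div ha hb]
  have hexp_neg :
      a * Real.exp (-ηs) = √(a * b) * Real.exp (-Real.arsinh (r / (2 * √(a * b)))) := by
    rw [hηs, neg_add, Real.exp_add, ← mul_assoc, mul_exp_neg_half_log_div ha hb]
  have hsub : b * Real.exp ηs - a * Real.exp (-ηs) = r := by
    have h := Real.sinh_arsinh (r / (2 * √(a * b)))
    rw [Real.sinh_eq] at h
    rw [hexp, hexp_neg, ← mul_sub, (div_eq_iff two_ne_zero).mp h]
    field_simp
  have hadd : b * Real.exp ηs + a * Real.exp (-ηs) = √(4 * a * b + r ^ 2) := by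
    symm
    rw [Real.sqrt_eq_iff_mul_self_eq (by positivity) (by positivity)]
    have h : Real.exp ηs * Real.exp (-ηs) = 1 := by rw [← Real.exp_add]; simp
    rw [← hsub]
    linear_combination -4 * a * b * h
  have hlt : ∀ η : ℝ, η ≠ ηs → f ηs < f η := by
    intro η hη
    have ht : η - ηs ≠ 0 := sub_ne_zero.mpr hη
    have h1 := Real.add_one_lt_exp ht
    have h2 := Real.add_one_lt_exp (neg_ne_zero.mpr ht)
    have e1 : Real.exp η = Real.exp ηs * Real.exp (η - ηs) := by
      rw [← Real.exp_add]; ring_nf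
    have e2 : Real.exp (-η) = Real.exp (-ηs) * Real.exp (-(η - ηs)) := by
      rw [← Real.exp_add]; ring_nf
    have p1 := mul_lt_mul_of_pos_left h1 (mul_pos hb (Real.exp_pos ηs))
    have p2 := mul_lt_mul_of_pos_left h2 (mul_pos ha (Real.exp_pos (-ηs)))
    have hr : (b * Real.exp ηs - a * Real.exp (-ηs)) * (η - ηs) = r * (η - ηs) := by rw [hsub]
    rw [hf, hf, e1, e2]
    linarith
  refine ⟨hlt, ?_⟩
  have hmin : ∀ η, f ηs ≤ f η := fun η => by
    rcases eq_or_ne η ηs with rfl | h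
    · exact le_rfl
    · exact (hlt η h).le
  have hinf : (⨅ η : ℝ, f η) = f ηs :=
    le_antisymm (ciInf_le ⟨f ηs, Set.forall_mem_range.mpr hmin⟩ ηs) (le_ciInf hmin)
  rw [hinf, hf, ← hadd]
  linear_combination -r * hηs
end

section
/- For every r ∈ ℝ, the function s ↦ r·arsinh(r/(2·√s)) − √(4·s + r²) is strictly decreasing on (0, ∞). -/
theorem Real.monotone_mul_arsinh_mul (r : ℝ) : Monotone fun c : ℝ => r * Real.arsinh (r * c) := by
  intro c d hcd
  rcases le_total 0 r with hr | hr
  · exact mul_le_mul_of_nonneg_left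
      (Real.arsinh_le_arsinh.2 (mul_le_mul_of_nonneg_left hcd hr)) hr
  · exact mul_le_mul_of_nonpos_left
      (Real.arsinh_le_arsinh.2 (mul_le_mul_of_nonpos_left hcd hr)) hr

/-- Monotonicity used in the proof of Proposition 3.6 of the paper: for every `r ∈ ℝ`,
the function `s ↦ r·arsinh(r/(2√s)) - √(4s + r²)` is strictly decreasing on `(0, ∞)`. -/
theorem zigzag_arsinh_term_strictAntiOn (r : ℝ) :
    StrictAntiOn
      (fun s : ℝ => r * Real.arsinh (r / (2 * Real.sqrt s)) - Real.sqrt (4 * s + r ^ 2))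
      (Set.Ioi 0) := by
  intro a ha b _ hab
  have ha : 0 < a := ha
  have hinv : (2 * √b)⁻¹ ≤ (2 * √a)⁻¹ := by gcongr
  have harsinh := Real.monotone_mul_arsinh_mul r hinv
  have hsqrt : √(4 * a + r ^ 2) < √(4 * b + r ^ 2) :=
    Real.sqrt_lt_sqrt (by positivity) (by linarith)
  simp only [← div_eq_mul_inv] at harsinh
  dsimp only
  linarith
end

section
/- Fix u, w ∈ ℝ. For γ > 0, set λ⁺(γ) = γ + max(u, 0), λ⁻(γ) = γ + max(−u, 0), and F(γ) = −(w/2)·log(λ⁺(γ)/λ⁻(γ)) + w·arsinh( w/(2·√(λ⁺(γ)·λ⁻(γ))) ) − √(4·λ⁺(γ)·λ⁻(γ) + w²) + λ⁺(γ) + λ⁻(γ). Then F is non-increasing on (0, ∞); moreover, if w ≠ u, then F is strictly decreasing on (0, ∞). -/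
/-- The exponential of the maximiser of `z ↦ w * z - p * (exp z - 1) - m * (exp (-z) - 1)`. -/
theorem exp_arsinh_sub_half_log {p m : ℝ} (hp : 0 < p) (hm : 0 < m) (w : ℝ) :
    Real.exp (Real.arsinh (w / (2 * √(p * m))) - Real.log (p / m) / 2) =
      (√(4 * p * m + w ^ 2) + w) / (2 * p) := by
  have hr : 0 < √p := Real.sqrt_pos.2 hp
  have ht : 0 < √m := Real.sqrt_pos.2 hm
  have hlog : Real.exp (Real.log (p / m) / 2) = √p / √m := by
    rw [← Real.log_sqrt (by positivity), Real.exp_log (by positivity), Real.sqrt_div hp.le]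
  have hsqrt : √(1 + (w / (2 * √(p * m))) ^ 2) = √(4 * p * m + w ^ 2) / (2 * (√p * √m)) := by
    rw [Real.sqrt_eq_iff_eq_sq (by positivity) (by positivity), div_pow, div_pow,
      Real.sq_sqrt (by positivity), mul_pow, mul_pow, mul_pow, Real.sq_sqrt (by positivity),
      Real.sq_sqrt hp.le, Real.sq_sqrt hm.le]
    field_simp
    ring
  rw [Real.exp_sub, Real.exp_arsinh, hlog, hsqrt, Real.sqrt_mul hp.le]
  field_simp
  rw [Real.sq_sqrt hp.le]
  ring

theorem mul_exp_neg_arsinh_sub_half_log {p m : ℝ} (hp : 0 < p) (hm : 0 < m) (w : ℝ) :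
    m * Real.exp (-(Real.arsinh (w / (2 * √(p * m))) - Real.log (p / m) / 2)) =
      (√(4 * p * m + w ^ 2) - w) / 2 := by
  have h := exp_arsinh_sub_half_log hp hm w
  have hpos := Real.exp_pos (Real.arsinh (w / (2 * √(p * m))) - Real.log (p / m) / 2)
  have hsq : √(4 * p * m + w ^ 2) ^ 2 = 4 * p * m + w ^ 2 := Real.sq_sqrt (by positivity)
  rw [h] at hpos
  have hne : 0 < √(4 * p * m + w ^ 2) + w := (div_pos_iff_of_pos_right (by positivity)).1 hpos
  rw [Real.exp_neg, h, inv_div, mul_div_assoc', div_eq_div_iff hne.ne' two_ne_zero]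
  linear_combination -hsq

/-- A critical point of the concave function `z ↦ w * z - p * exp z - m * exp (-z)` is a
maximiser. -/
theorem mul_sub_exp_le_of_critical {p m w z : ℝ} (hp : 0 ≤ p) (hm : 0 ≤ m)
    (hz : p * Real.exp z - m * Real.exp (-z) = w) (y : ℝ) :
    w * y - p * Real.exp y - m * Real.exp (-y) ≤
      w * z - p * Real.exp z - m * Real.exp (-z) := by
  have tangent (a b : ℝ) : Real.exp a * (b - a + 1) ≤ Real.exp b := by
    have h := mul_le_mul_of_nonneg_left (Real.add_one_le_exp (b - a)) (Real.exp_pos a).le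
    rwa [← Real.exp_add, add_sub_cancel] at h
  have h₁ := mul_le_mul_of_nonneg_left (tangent z y) hp
  have h₂ := mul_le_mul_of_nonneg_left (tangent (-z) (-y)) hm
  subst hz
  linarith

/-- The closed form of the Legendre transform of `z ↦ p * (exp z - 1) + m * (exp (-z) - 1)`
at `w`, together with the critical point equation. -/
theorem exists_critical_eq_closed_form {p m : ℝ} (hp : 0 < p) (hm : 0 < m) (w : ℝ) :
    ∃ z, p * Real.exp z - m * Real.exp (-z) = w ∧
      -(w / 2) * Real.log (p / m) + w * Real.arsinh (w / (2 * √(p * m)))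
        - √(4 * p * m + w ^ 2) + p + m =
      w * z - p * Real.exp z - m * Real.exp (-z) + p + m := by
  have h₁ : p * Real.exp (Real.arsinh (w / (2 * √(p * m))) - Real.log (p / m) / 2) =
      (√(4 * p * m + w ^ 2) + w) / 2 := by
    rw [exp_arsinh_sub_half_log hp hm w]
    field_simp
  have h₂ := mul_exp_neg_arsinh_sub_half_log hp hm w
  refine ⟨Real.arsinh (w / (2 * √(p * m))) - Real.log (p / m) / 2, ?_, ?_⟩
  · linarith
  · rw [h₁, h₂]
    ring

theorem two_lt_exp_add_exp_neg {z : ℝ} (hz : z ≠ 0) : 2 < Real.exp z + Real.exp (-z) := by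
  linarith [Real.add_one_lt_exp hz, Real.add_one_lt_exp (neg_ne_zero.2 hz)]

/-- Monotonicity in the refreshment rate γ of the integrand of the explicit zig-zag
rate function (Section 3.3 of the paper): with `λ⁺(γ) = γ + max(u,0)`,
`λ⁻(γ) = γ + max(-u,0)` and
`F(γ) = -(w/2)·log(λ⁺/λ⁻) + w·arsinh(w/(2√(λ⁺λ⁻))) - √(4λ⁺λ⁻ + w²) + λ⁺ + λ⁻`,
the function `F` is non-increasing on `(0, ∞)`, and strictly decreasing there
if `w ≠ u`. -/
theorem zigzag_rate_integrand_antitone (u w : ℝ) (lp lm F : ℝ → ℝ)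
    (hlp : ∀ γ, lp γ = γ + max u 0) (hlm : ∀ γ, lm γ = γ + max (-u) 0)
    (hF : ∀ γ, F γ =
      -(w / 2) * Real.log (lp γ / lm γ)
        + w * Real.arsinh (w / (2 * Real.sqrt (lp γ * lm γ)))
        - Real.sqrt (4 * lp γ * lm γ + w ^ 2) + lp γ + lm γ) :
    AntitoneOn F (Set.Ioi 0) ∧ (w ≠ u → StrictAntiOn F (Set.Ioi 0)) := by
  have key {a b : ℝ} (ha : 0 < a) (hab : a < b) : F b ≤ F a ∧ (w ≠ u → F b < F a) := by
    have hb : 0 < b := ha.trans hab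
    have hu : max u 0 - max (-u) 0 = u := by
      rcases le_total u 0 with h | h <;> simp [h]
    have pos {c : ℝ} (hc : 0 < c) : 0 < lp c ∧ 0 < lm c := by
      rw [hlp, hlm]
      exact ⟨add_pos_of_pos_of_nonneg hc (le_max_right _ _),
        add_pos_of_pos_of_nonneg hc (le_max_right _ _)⟩
    obtain ⟨x, hx, hFx⟩ := exists_critical_eq_closed_form (pos ha).1 (pos ha).2 w
    obtain ⟨z, hz, hFz⟩ := exists_critical_eq_closed_form (pos hb).1 (pos hb).2 w
    rw [← hF] at hFx hFz
    have hle := mul_sub_exp_le_of_critical (pos ha).1.le (pos ha).2.le hx z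
    have hdiff : F b + (b - a) * (Real.exp z + Real.exp (-z) - 2) ≤ F a := by
      rw [hFx, hFz]
      simp only [hlp, hlm] at hle ⊢
      linarith
    by_cases h0 : z = 0
    · subst h0
      refine ⟨by norm_num at hdiff; linarith, fun hwu => absurd ?_ hwu⟩
      simp only [neg_zero, Real.exp_zero, hlp, hlm] at hz
      linarith
    · have := mul_pos (sub_pos.2 hab) (sub_pos.2 (two_lt_exp_add_exp_neg h0))
      exact ⟨by linarith, fun _ => by linarith⟩
  refine ⟨fun a ha b _ hab => ?_, fun hwu a ha b _ hab => (key ha hab).2 hwu⟩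
  rcases hab.eq_or_lt with rfl | h
  · exact le_rfl
  · exact (key ha h).1
end

section
/- Let λ⁺, λ⁻ : ℝ → ℝ be continuous, nonnegative, 1-periodic functions, and let ρ⁺, ρ⁻ : ℝ → [0, ∞) be twice continuously differentiable 1-periodic functions. If the Lebesgue measure of the set {x ∈ [0,1] : (ρ⁺)'(x) ≠ (ρ⁻)'(x)} is strictly positive, then the infimum of H(u⁺, u⁻) over all pairs of continuously differentiable 1-periodic functions u⁺, u⁻ : ℝ → (0, ∞) equals −∞. -/
/-- Lemma 5.1 of the paper: if the derivatives of the densities `ρ⁺` and `ρ⁻` differ on a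
set of positive Lebesgue measure, then the infimum of the Donsker–Varadhan functional
`H(u⁺,u⁻) = ∫₀¹ [(u⁺'/u⁺ + λ⁺(u⁻/u⁺ - 1))ρ⁺ + (-u⁻'/u⁻ + λ⁻(u⁺/u⁻ - 1))ρ⁻] dx`
over pairs of continuously differentiable, 1-periodic, strictly positive functions
equals `-∞`. -/
theorem zigzag_rate_infinite_of_deriv_mismatch (lp lm ρp ρm : ℝ → ℝ)
    (hlpc : Continuous lp) (hlmc : Continuous lm)
    (hlp0 : ∀ x, 0 ≤ lp x) (hlm0 : ∀ x, 0 ≤ lm x)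
    (hlpper : Function.Periodic lp 1) (hlmper : Function.Periodic lm 1)
    (hρp : ContDiff ℝ 2 ρp) (hρm : ContDiff ℝ 2 ρm)
    (hρpper : Function.Periodic ρp 1) (hρmper : Function.Periodic ρm 1)
    (hρp0 : ∀ x, 0 ≤ ρp x) (hρm0 : ∀ x, 0 ≤ ρm x)
    (H : (ℝ → ℝ) → (ℝ → ℝ) → ℝ)
    (hH : ∀ up um : ℝ → ℝ, H up um =
      ∫ x in (0:ℝ)..1,
        ((deriv up x / up x + lp x * (um x / up x - 1)) * ρp x
          + (-(deriv um x) / um x + lm x * (up x / um x - 1)) * ρm x))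
    (hmismatch : 0 < MeasureTheory.volume {x ∈ Set.Icc (0:ℝ) 1 | deriv ρp x ≠ deriv ρm x}) :
    ∀ M : ℝ, ∃ up um : ℝ → ℝ,
      ContDiff ℝ 1 up ∧ ContDiff ℝ 1 um ∧
      Function.Periodic up 1 ∧ Function.Periodic um 1 ∧
      (∀ x, 0 < up x) ∧ (∀ x, 0 < um x) ∧
      H up um < M := by
  set f : ℝ → ℝ := fun x => deriv ρp x - deriv ρm x with hf
  have hfC : ContDiff ℝ 1 f :=
    (ContDiff.iterate_deriv' 1 1 hρp).sub (ContDiff.iterate_deriv' 1 1 hρm)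
  have hfd : Differentiable ℝ f := hfC.differentiable one_ne_zero
  have hf'c : Continuous (deriv f) := hfC.continuous_deriv le_rfl
  have hfper : Function.Periodic f 1 := fun x => by
    have hshift : ∀ g : ℝ → ℝ, Function.Periodic g 1 → deriv g (x + 1) = deriv g x := by
      intro g hg
      rw [← deriv_comp_add_const g 1 x, funext hg]
    simp only [hf, hshift ρp hρpper, hshift ρm hρmper]
  have hpos : 0 < ∫ x in (0:ℝ)..1, f x * f x := by
    obtain ⟨c, hc, hne⟩ := MeasureTheory.nonempty_of_measure_ne_zero hmismatch.ne'
    exact intervalIntegral.integral_pos one_pos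
      (hfC.continuous.mul hfC.continuous).continuousOn
      (fun x _ => mul_self_nonneg _) ⟨c, hc, mul_self_pos.mpr (sub_ne_zero.mpr hne)⟩
  have hparts : ∫ x in (0:ℝ)..1, deriv f x * (ρp x - ρm x) = -∫ x in (0:ℝ)..1, f x * f x := by
    have hg : ∀ x, HasDerivAt (fun y => ρp y - ρm y) (f x) x := fun x =>
      (hρp.differentiable two_ne_zero x).hasDerivAt.sub
        (hρm.differentiable two_ne_zero x).hasDerivAt
    have h := intervalIntegral.integral_mul_deriv_eq_deriv_mul (a := 0) (b := 1)
      (fun x _ => (hfd x).hasDerivAt) (fun x _ => hg x)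
      (hf'c.intervalIntegrable 0 1) (hfC.continuous.intervalIntegrable 0 1)
    have h1 : f 1 = f 0 := by simpa using hfper 0
    have h2 : ρp 1 = ρp 0 := by simpa using hρpper 0
    have h3 : ρm 1 = ρm 0 := by simpa using hρmper 0
    rw [h1, h2, h3] at h
    linarith
  intro M
  set t : ℝ := (|M| + 1) / ∫ x in (0:ℝ)..1, f x * f x with ht
  have huC : ContDiff ℝ 1 (fun x => Real.exp (t * f x)) := (contDiff_const.mul hfC).exp
  have huper : Function.Periodic (fun x => Real.exp (t * f x)) 1 := fun x => by
    simp only [hfper x]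
  refine ⟨_, _, huC, huC, huper, huper, fun x => Real.exp_pos _, fun x => Real.exp_pos _, ?_⟩
  have hderiv : ∀ x, deriv (fun x => Real.exp (t * f x)) x
      = Real.exp (t * f x) * (t * deriv f x) := fun x =>
    ((hfd x).hasDerivAt.const_mul t).exp.deriv
  have hval : H (fun x => Real.exp (t * f x)) (fun x => Real.exp (t * f x))
      = t * ∫ x in (0:ℝ)..1, deriv f x * (ρp x - ρm x) := by
    rw [hH, ← intervalIntegral.integral_const_mul]
    refine intervalIntegral.integral_congr fun x _ => ?_
    have hne := (Real.exp_pos (t * f x)).ne'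
    simp only [hderiv]
    field_simp
    ring
  rw [hval, hparts, mul_neg, ht, div_mul_cancel₀ _ hpos.ne']
  linarith [neg_abs_le M]
end

section
/- Let λ⁺, λ⁻ : ℝ → (0, ∞) be continuous 1-periodic functions, and let ρ⁺, ρ⁻ : ℝ → [0, ∞) be continuously differentiable 1-periodic functions with (ρ⁺)'(x) = (ρ⁻)'(x) =: ρ'(x) for all x ∈ ℝ. Then the infimum of H(u⁺, u⁻) over all pairs of continuously differentiable 1-periodic functions u⁺, u⁻ : ℝ → (0, ∞) equals the infimum over all continuous 1-periodic functions η : ℝ → ℝ of ∫₀¹ [ −ρ'(x)·η(x) + λ⁺(x)·ρ⁺(x)·(exp(−η(x)) − 1) + λ⁻(x)·ρ⁻(x)·(exp(η(x)) − 1) ] dx. -/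
/-- The average of `η` over the segment from `x` to `x + h`. -/
noncomputable def segmentAverage (η : ℝ → ℝ) (h x : ℝ) : ℝ :=
  ∫ t in (0:ℝ)..1, η (x + h * t)

theorem segmentAverage_zero (η : ℝ → ℝ) (x : ℝ) : segmentAverage η 0 x = η x := by
  simp [segmentAverage]

theorem continuous_uncurry_segmentAverage {η : ℝ → ℝ} (hη : Continuous η) :
    Continuous fun p : ℝ × ℝ => segmentAverage η p.1 p.2 := by
  unfold segmentAverage
  apply intervalIntegral.continuous_parametric_intervalIntegral_of_continuous'
  fun_prop

theorem Function.Periodic.segmentAverage {η : ℝ → ℝ} {c : ℝ} (hη : Function.Periodic η c)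
    (h : ℝ) : Function.Periodic (segmentAverage η h) c := by
  intro x
  unfold _root_.segmentAverage
  congr 1 with t
  rw [show x + c + h * t = x + h * t + c by ring, hη]

theorem contDiff_one_segmentAverage {η : ℝ → ℝ} (hη : Continuous η) {h : ℝ} (hh : h ≠ 0) :
    ContDiff ℝ 1 (segmentAverage η h) := by
  have hF : ContDiff ℝ 1 fun x => ∫ t in (0:ℝ)..x, η t := by
    have hd : ∀ x, HasDerivAt (fun x => ∫ t in (0:ℝ)..x, η t) (η x) x := fun x =>
      hη.integral_hasStrictDerivAt 0 x |>.hasDerivAt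
    rw [contDiff_one_iff_deriv]
    refine ⟨fun x => (hd x).differentiableAt, ?_⟩
    rwa [show deriv (fun x => ∫ t in (0:ℝ)..x, η t) = η from funext fun x => (hd x).deriv]
  have heq : segmentAverage η h =
      fun x => h⁻¹ * ((∫ t in (0:ℝ)..(x + h), η t) - ∫ t in (0:ℝ)..x, η t) := by
    funext x
    rw [intervalIntegral.integral_interval_sub_left (hη.intervalIntegrable _ _)
      (hη.intervalIntegrable _ _), segmentAverage, intervalIntegral.integral_comp_add_mul _ hh]
    simp
  rw [heq]
  exact contDiff_const.mul ((hF.comp (contDiff_id.add contDiff_const)).sub hF)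

/-- A continuous functional of the value takes, at a continuous periodic function, a value in the
closure of those it takes at continuously differentiable periodic functions. -/
theorem integral_mem_closure_contDiff_periodic {L : ℝ → ℝ → ℝ}
    (hL : Continuous fun p : ℝ × ℝ => L p.1 p.2) {η : ℝ → ℝ} {c : ℝ} (hη : Continuous η)
    (hper : Function.Periodic η c) (a b : ℝ) :
    ∫ x in a..b, L x (η x) ∈
      closure {y : ℝ | ∃ ζ : ℝ → ℝ, ContDiff ℝ 1 ζ ∧ Function.Periodic ζ c ∧
        ∫ x in a..b, L x (ζ x) = y} := by
  have hcont : Continuous fun h => ∫ x in a..b, L x (segmentAverage η h x) := by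
    apply intervalIntegral.continuous_parametric_intervalIntegral_of_continuous'
    exact hL.comp (continuous_snd.prodMk (continuous_uncurry_segmentAverage hη))
  have h0 : (0:ℝ) ∈ closure {(0:ℝ)}ᶜ := by
    rw [closure_compl_singleton]; trivial
  have := map_mem_closure hcont h0 fun h (hh : h ≠ 0) =>
    show _ ∈ {y : ℝ | ∃ ζ : ℝ → ℝ, ContDiff ℝ 1 ζ ∧ Function.Periodic ζ c ∧
        ∫ x in a..b, L x (ζ x) = y} from
      ⟨_, contDiff_one_segmentAverage hη hh, hper.segmentAverage h, rfl⟩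
  simpa only [segmentAverage_zero] using this

theorem Real.sInf_eq_of_subset_of_subset_closure {S T : Set ℝ} (hST : S ⊆ T)
    (hTS : T ⊆ closure S) : sInf S = sInf T := by
  have hlb : lowerBounds S = lowerBounds T :=
    (lowerBounds_closure S ▸ lowerBounds_mono_set hTS).antisymm (lowerBounds_mono_set hST)
  rcases T.eq_empty_or_nonempty with rfl | hT
  · rw [Set.subset_empty_iff.1 hST]
  have hS : S.Nonempty := closure_nonempty_iff.1 (hT.mono hTS)
  by_cases hb : BddBelow S
  · have hg : IsGLB T (sInf S) := by
      have := isGLB_csInf hS hb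
      rwa [IsGLB, hlb] at this
    exact (hg.csInf_eq hT).symm
  · have hb' : ¬ BddBelow T := by rwa [BddBelow, ← hlb]
    rw [Real.sInf_of_not_bddBelow hb, Real.sInf_of_not_bddBelow hb']

/-- Integration by parts turns the Donsker–Varadhan integrand of `(up, um)` into a functional of
`log up - log um`. -/
theorem integral_zigzag_eq_integral_log_sub_log {lp lm ρp ρm up um : ℝ → ℝ}
    (hlpc : Continuous lp) (hlmc : Continuous lm)
    (hρp : ContDiff ℝ 1 ρp) (hρm : ContDiff ℝ 1 ρm)
    (hρpper : Function.Periodic ρp 1) (hρmper : Function.Periodic ρm 1)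
    (hderiv : ∀ x, deriv ρp x = deriv ρm x)
    (hup : ContDiff ℝ 1 up) (hum : ContDiff ℝ 1 um)
    (hupper : Function.Periodic up 1) (humper : Function.Periodic um 1)
    (hup0 : ∀ x, 0 < up x) (hum0 : ∀ x, 0 < um x) :
    (∫ x in (0:ℝ)..1,
        ((deriv up x / up x + lp x * (um x / up x - 1)) * ρp x
          + (-(deriv um x) / um x + lm x * (up x / um x - 1)) * ρm x)) =
      ∫ x in (0:ℝ)..1,
        (-(deriv ρp x) * (Real.log (up x) - Real.log (um x))
          + lp x * ρp x * (Real.exp (-(Real.log (up x) - Real.log (um x))) - 1)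
          + lm x * ρm x * (Real.exp (Real.log (up x) - Real.log (um x)) - 1)) := by
  have hupne : ∀ x, up x ≠ 0 := fun x => (hup0 x).ne'
  have humne : ∀ x, um x ≠ 0 := fun x => (hum0 x).ne'
  have hdup := hup.continuous_deriv le_rfl
  have hdum := hum.continuous_deriv le_rfl
  have hdρp := hρp.continuous_deriv le_rfl
  have hupc := hup.continuous
  have humc := hum.continuous
  have hρpc := hρp.continuous
  have hρmc := hρm.continuous
  have hlogp : Continuous fun x => Real.log (up x) := hupc.log hupne
  have hlogm : Continuous fun x => Real.log (um x) := humc.log humne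
  rw [← sub_eq_zero, ← intervalIntegral.integral_sub]
  · have hprim : ∀ x, HasDerivAt (fun x => Real.log (up x) * ρp x - Real.log (um x) * ρm x)
        (deriv up x / up x * ρp x + Real.log (up x) * deriv ρp x
          - (deriv um x / um x * ρm x + Real.log (um x) * deriv ρm x)) x := fun x =>
      (((hup.differentiable one_ne_zero x).hasDerivAt.log (hupne x)).mul
          (hρp.differentiable one_ne_zero x).hasDerivAt).sub
        (((hum.differentiable one_ne_zero x).hasDerivAt.log (humne x)).mul
          (hρm.differentiable one_ne_zero x).hasDerivAt)
    rw [intervalIntegral.integral_eq_sub_of_hasDerivAt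
      (f := fun x => Real.log (up x) * ρp x - Real.log (um x) * ρm x)]
    · have h1 := hupper 0
      have h2 := humper 0
      have h3 := hρpper 0
      have h4 := hρmper 0
      rw [zero_add] at h1 h2 h3 h4
      simp only [h1, h2, h3, h4, sub_self]
    · intro x _
      refine (hprim x).congr_deriv ?_
      rw [neg_sub, Real.exp_sub, Real.exp_sub, Real.exp_log (hup0 x), Real.exp_log (hum0 x),
        ← hderiv x]
      ring
    · apply Continuous.intervalIntegrable
      fun_prop (disch := assumption)
  · apply Continuous.intervalIntegrable
    fun_prop (disch := assumption)
  · apply Continuous.intervalIntegrable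
    fun_prop


/-- Lemma 5.2 of the paper (reparametrization of the Donsker–Varadhan functional): when
`(ρ⁺)' = (ρ⁻)'`, the infimum of
`H(u⁺,u⁻) = ∫₀¹ [(u⁺'/u⁺ + λ⁺(u⁻/u⁺ - 1))ρ⁺ + (-u⁻'/u⁻ + λ⁻(u⁺/u⁻ - 1))ρ⁻] dx`
over pairs of continuously differentiable, 1-periodic, positive functions equals the
infimum over continuous 1-periodic `η` of
`∫₀¹ [-ρ'·η + λ⁺ρ⁺(exp(-η) - 1) + λ⁻ρ⁻(exp(η) - 1)] dx`. -/
theorem zigzag_rate_reparametrization (lp lm ρp ρm : ℝ → ℝ)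
    (hlpc : Continuous lp) (hlmc : Continuous lm)
    (hlp0 : ∀ x, 0 < lp x) (hlm0 : ∀ x, 0 < lm x)
    (hlpper : Function.Periodic lp 1) (hlmper : Function.Periodic lm 1)
    (hρp : ContDiff ℝ 1 ρp) (hρm : ContDiff ℝ 1 ρm)
    (hρpper : Function.Periodic ρp 1) (hρmper : Function.Periodic ρm 1)
    (hρp0 : ∀ x, 0 ≤ ρp x) (hρm0 : ∀ x, 0 ≤ ρm x)
    (hderiv : ∀ x, deriv ρp x = deriv ρm x)
    (H : (ℝ → ℝ) → (ℝ → ℝ) → ℝ)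
    (hH : ∀ up um : ℝ → ℝ, H up um =
      ∫ x in (0:ℝ)..1,
        ((deriv up x / up x + lp x * (um x / up x - 1)) * ρp x
          + (-(deriv um x) / um x + lm x * (up x / um x - 1)) * ρm x)) :
    sInf {y : ℝ | ∃ up um : ℝ → ℝ,
        ContDiff ℝ 1 up ∧ ContDiff ℝ 1 um ∧
        Function.Periodic up 1 ∧ Function.Periodic um 1 ∧
        (∀ x, 0 < up x) ∧ (∀ x, 0 < um x) ∧ H up um = y} =
      sInf {y : ℝ | ∃ η : ℝ → ℝ,
        Continuous η ∧ Function.Periodic η 1 ∧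
        (∫ x in (0:ℝ)..1,
          (-(deriv ρp x) * η x + lp x * ρp x * (Real.exp (-η x) - 1)
            + lm x * ρm x * (Real.exp (η x) - 1))) = y} := by
  apply Real.sInf_eq_of_subset_of_subset_closure
  · rintro _ ⟨up, um, hup, hum, hupper, humper, hup0, hum0, rfl⟩
    refine ⟨fun x => Real.log (up x) - Real.log (um x),
      (hup.continuous.log fun x => (hup0 x).ne').sub (hum.continuous.log fun x => (hum0 x).ne'),
      fun x => by simp only [hupper x, humper x], ?_⟩
    rw [hH, integral_zigzag_eq_integral_log_sub_log hlpc hlmc hρp hρm hρpper hρmper hderiv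
      hup hum hupper humper hup0 hum0]
  · rintro _ ⟨η, hη, hper, rfl⟩
    have hdρp := hρp.continuous_deriv le_rfl
    have hρpc := hρp.continuous
    have hρmc := hρm.continuous
    refine closure_mono ?_ (integral_mem_closure_contDiff_periodic
      (L := fun x s => -(deriv ρp x) * s + lp x * ρp x * (Real.exp (-s) - 1)
        + lm x * ρm x * (Real.exp s - 1)) (by fun_prop) hη hper 0 1)
    rintro _ ⟨ζ, hζ, hζper, rfl⟩
    have hup : ContDiff ℝ 1 fun x => Real.exp (ζ x) := hζ.exp
    have hum : ContDiff ℝ 1 fun _ : ℝ => (1:ℝ) := contDiff_const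
    have hupper : Function.Periodic (fun x => Real.exp (ζ x)) 1 := fun x => by
      simp only [hζper x]
    have humper : Function.Periodic (fun _ : ℝ => (1:ℝ)) 1 := fun _ => rfl
    refine ⟨_, _, hup, hum, hupper, humper, fun x => Real.exp_pos _, fun _ => one_pos, ?_⟩
    rw [hH, integral_zigzag_eq_integral_log_sub_log hlpc hlmc hρp hρm hρpper hρmper hderiv
      hup hum hupper humper (fun x => Real.exp_pos _) fun _ => one_pos]
    simp only [Real.log_exp, Real.log_one, sub_zero]
end

section
/- Let λ⁺, λ⁻ : ℝ → (0, ∞) be continuous 1-periodic functions, and let ρ⁺, ρ⁻ : ℝ → (0, ∞) be continuously differentiable 1-periodic functions with (ρ⁺)'(x) = (ρ⁻)'(x) =: ρ'(x) for all x ∈ ℝ. Then −inf over all continuous 1-periodic functions η : ℝ → ℝ of ∫₀¹ [ −ρ'(x)·η(x) + λ⁺(x)·ρ⁺(x)·(exp(−η(x)) − 1) + λ⁻(x)·ρ⁻(x)·(exp(η(x)) − 1) ] dx equals ∫₀¹ [ (1/2)·ρ'(x)·log( λ⁺(x)·ρ⁺(x) / (λ⁻(x)·ρ⁻(x)) ) +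 ρ'(x)·arsinh( ρ'(x) / (2·√(λ⁺(x)·λ⁻(x)·ρ⁺(x)·ρ⁻(x))) ) − √( 4·λ⁺(x)·λ⁻(x)·ρ⁺(x)·ρ⁻(x) + ρ'(x)² ) + λ⁺(x)·ρ⁺(x) + λ⁻(x)·ρ⁻(x) ] dx. -/
namespace ZigZag

/-- The critical point of `t ↦ -r * t + a * (exp (-t) - 1) + b * (exp t - 1)`. -/
noncomputable def minimizer (a b r : ℝ) : ℝ :=
  1 / 2 * Real.log (a / b) + Real.arsinh (r / (2 * Real.sqrt (a * b)))

lemma exp_half_log_div {a b : ℝ} (ha : 0 < a) (hb : 0 < b) :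
    b * Real.exp (1 / 2 * Real.log (a / b)) = Real.sqrt (a * b) := by
  refine ((Real.sqrt_eq_iff_mul_self_eq (by positivity) (by positivity)).2 ?_).symm
  have h : Real.exp (1 / 2 * Real.log (a / b)) * Real.exp (1 / 2 * Real.log (a / b)) = a / b := by
    rw [← Real.exp_add, ← add_mul, add_halves, one_mul, Real.exp_log (div_pos ha hb)]
  rw [mul_mul_mul_comm, h]
  field_simp

lemma mul_exp_minimizer {a b : ℝ} (ha : 0 < a) (hb : 0 < b) (r : ℝ) :
    b * Real.exp (minimizer a b r) = (Real.sqrt (4 * (a * b) + r ^ 2) + r) / 2 := by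
  have hs : 0 < Real.sqrt (a * b) := Real.sqrt_pos.2 (mul_pos ha hb)
  have hsq : Real.sqrt (a * b) ^ 2 = a * b := Real.sq_sqrt (mul_pos ha hb).le
  have hroot : Real.sqrt (4 * (a * b) + r ^ 2) =
      2 * Real.sqrt (a * b) * Real.sqrt (1 + (r / (2 * Real.sqrt (a * b))) ^ 2) := by
    rw [Real.sqrt_eq_iff_mul_self_eq (by positivity) (by positivity), mul_mul_mul_comm,
      Real.mul_self_sqrt (by positivity)]
    field_simp
    rw [hsq]
    ring
  rw [minimizer, Real.exp_add, ← mul_assoc, exp_half_log_div ha hb, Real.exp_arsinh, hroot]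
  field_simp
  ring

lemma mul_exp_neg_minimizer {a b : ℝ} (ha : 0 < a) (hb : 0 < b) (r : ℝ) :
    a * Real.exp (-minimizer a b r) = (Real.sqrt (4 * (a * b) + r ^ 2) - r) / 2 := by
  have hflip : -minimizer a b r = minimizer b a (-r) := by
    rw [minimizer, minimizer, neg_div, Real.arsinh_neg, mul_comm b a, ← inv_div a b, Real.log_inv]
    ring
  rw [hflip, mul_exp_minimizer hb ha, mul_comm b a, neg_sq, sub_eq_add_neg]

lemma value_minimizer {a b : ℝ} (ha : 0 < a) (hb : 0 < b) (r : ℝ) :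
    -r * minimizer a b r + a * (Real.exp (-minimizer a b r) - 1)
        + b * (Real.exp (minimizer a b r) - 1) =
      -(1 / 2 * r * Real.log (a / b) + r * Real.arsinh (r / (2 * Real.sqrt (a * b)))
        - Real.sqrt (4 * (a * b) + r ^ 2) + a + b) := by
  rw [mul_sub, mul_sub, mul_exp_minimizer ha hb, mul_exp_neg_minimizer ha hb, minimizer]
  ring

lemma value_minimizer_le {a b : ℝ} (ha : 0 < a) (hb : 0 < b) (r t : ℝ) :
    -r * minimizer a b r + a * (Real.exp (-minimizer a b r) - 1)
        + b * (Real.exp (minimizer a b r) - 1) ≤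
      -r * t + a * (Real.exp (-t) - 1) + b * (Real.exp t - 1) := by
  have hB := mul_exp_minimizer ha hb r
  have hA := mul_exp_neg_minimizer ha hb r
  set m := minimizer a b r
  have h₁ : a * Real.exp (-m) * (m - t + 1) ≤ a * Real.exp (-t) := by
    rw [show -t = -m + (m - t) by ring, Real.exp_add, ← mul_assoc]
    exact mul_le_mul_of_nonneg_left (Real.add_one_le_exp _) (by positivity)
  have h₂ : b * Real.exp m * (t - m + 1) ≤ b * Real.exp t := by
    rw [show b * Real.exp t = b * Real.exp m * Real.exp (t - m) by
      rw [mul_assoc, ← Real.exp_add, add_sub_cancel]]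
    exact mul_le_mul_of_nonneg_left (Real.add_one_le_exp _) (by positivity)
  rw [mul_sub, mul_sub, mul_sub, mul_sub, hA, hB]
  rw [hA] at h₁
  rw [hB] at h₂
  linarith

lemma continuous_minimizer {a b r : ℝ → ℝ} (ha : Continuous a) (hb : Continuous b)
    (hr : Continuous r) (ha0 : ∀ x, 0 < a x) (hb0 : ∀ x, 0 < b x) :
    Continuous fun x => minimizer (a x) (b x) (r x) := by
  unfold minimizer
  refine (continuous_const.mul ((ha.div hb fun x => (hb0 x).ne').log
    fun x => (div_pos (ha0 x) (hb0 x)).ne')).add (Real.continuous_arsinh.comp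
      (hr.div (continuous_const.mul (ha.mul hb).sqrt) fun x => ?_))
  have := Real.sqrt_pos.2 (mul_pos (ha0 x) (hb0 x))
  positivity

end ZigZag


/-- Lemma 5.3 of the paper: in the reparametrized form of the zig-zag Donsker–Varadhan
functional, minus the infimum over continuous 1-periodic `η` of
`∫₀¹ [-ρ'·η + λ⁺ρ⁺(exp(-η) - 1) + λ⁻ρ⁻(exp(η) - 1)] dx` equals
`∫₀¹ [ (1/2)ρ'·log(λ⁺ρ⁺/(λ⁻ρ⁻)) + ρ'·arsinh(ρ'/(2√(λ⁺λ⁻ρ⁺ρ⁻)))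
      - √(4λ⁺λ⁻ρ⁺ρ⁻ + (ρ')²) + λ⁺ρ⁺ + λ⁻ρ⁻ ] dx`. -/
theorem zigzag_rate_explicit_reparam (lp lm ρp ρm : ℝ → ℝ)
    (hlpc : Continuous lp) (hlmc : Continuous lm)
    (hlp0 : ∀ x, 0 < lp x) (hlm0 : ∀ x, 0 < lm x)
    (hlpper : Function.Periodic lp 1) (hlmper : Function.Periodic lm 1)
    (hρp : ContDiff ℝ 1 ρp) (hρm : ContDiff ℝ 1 ρm)
    (hρpper : Function.Periodic ρp 1) (hρmper : Function.Periodic ρm 1)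
    (hρp0 : ∀ x, 0 < ρp x) (hρm0 : ∀ x, 0 < ρm x)
    (hderiv : ∀ x, deriv ρp x = deriv ρm x) :
    -sInf {y : ℝ | ∃ η : ℝ → ℝ,
        Continuous η ∧ Function.Periodic η 1 ∧
        (∫ x in (0:ℝ)..1,
          (-(deriv ρp x) * η x + lp x * ρp x * (Real.exp (-η x) - 1)
            + lm x * ρm x * (Real.exp (η x) - 1))) = y} =
      ∫ x in (0:ℝ)..1,
        ((1 / 2) * deriv ρp x * Real.log (lp x * ρp x / (lm x * ρm x))
          + deriv ρp x *
              Real.arsinh (deriv ρp x / (2 * Real.sqrt (lp x * lm x * ρp x * ρm x)))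
          - Real.sqrt (4 * lp x * lm x * ρp x * ρm x + (deriv ρp x) ^ 2)
          + lp x * ρp x + lm x * ρm x) := by
  have hr : Continuous (deriv ρp) := hρp.continuous_deriv le_rfl
  have hrper : Function.Periodic (deriv ρp) 1 := fun x => by
    rw [← deriv_comp_add_const, funext hρpper]
  have ha : Continuous fun x => lp x * ρp x := hlpc.mul hρp.continuous
  have hb : Continuous fun x => lm x * ρm x := hlmc.mul hρm.continuous
  have ha0 x : 0 < lp x * ρp x := mul_pos (hlp0 x) (hρp0 x)
  have hb0 x : 0 < lm x * ρm x := mul_pos (hlm0 x) (hρm0 x)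
  let ηmin : ℝ → ℝ := fun x => ZigZag.minimizer (lp x * ρp x) (lm x * ρm x) (deriv ρp x)
  have hηmin : Continuous ηmin := ZigZag.continuous_minimizer ha hb hr ha0 hb0
  have hηper : Function.Periodic ηmin 1 := fun x => by
    simp only [ηmin, hlpper x, hlmper x, hρpper x, hρmper x, hrper x]
  have hcont (η : ℝ → ℝ) (hη : Continuous η) : Continuous fun x =>
      -(deriv ρp x) * η x + lp x * ρp x * (Real.exp (-η x) - 1)
        + lm x * ρm x * (Real.exp (η x) - 1) := by
    fun_prop
  have hleast : IsLeast {y : ℝ | ∃ η : ℝ → ℝ,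
      Continuous η ∧ Function.Periodic η 1 ∧
      (∫ x in (0:ℝ)..1,
        (-(deriv ρp x) * η x + lp x * ρp x * (Real.exp (-η x) - 1)
          + lm x * ρm x * (Real.exp (η x) - 1))) = y}
      (∫ x in (0:ℝ)..1,
        (-(deriv ρp x) * ηmin x + lp x * ρp x * (Real.exp (-ηmin x) - 1)
          + lm x * ρm x * (Real.exp (ηmin x) - 1))) := by
    refine ⟨⟨ηmin, hηmin, hηper, rfl⟩, ?_⟩
    rintro _ ⟨η, hη, -, rfl⟩
    exact intervalIntegral.integral_mono_on zero_le_one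
      ((hcont ηmin hηmin).intervalIntegrable _ _) ((hcont η hη).intervalIntegrable _ _)
      fun x _ => ZigZag.value_minimizer_le (ha0 x) (hb0 x) _ _
  rw [hleast.csInf_eq, ← intervalIntegral.integral_neg]
  refine intervalIntegral.integral_congr fun x _ => ?_
  have hprod : lp x * ρp x * (lm x * ρm x) = lp x * lm x * ρp x * ρm x := by ring
  have hprod₄ : 4 * (lp x * lm x * ρp x * ρm x) = 4 * lp x * lm x * ρp x * ρm x := by ring
  simpa only [hprod, hprod₄] using neg_eq_iff_eq_neg.2
    (ZigZag.value_minimizer (ha0 x) (hb0 x) (deriv ρp x))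
end

section
/- Let λ⁺, λ⁻ : ℝ → (0, ∞) be continuous 1-periodic functions, and let ρ⁺, ρ⁻ : ℝ → (0, ∞) be continuously differentiable 1-periodic functions with (ρ⁺)'(x) = (ρ⁻)'(x) =: ρ'(x) for all x ∈ ℝ. Then −inf of H(u⁺, u⁻) over all pairs of continuously differentiable 1-periodic functions u⁺, u⁻ : ℝ → (0, ∞) equals ∫₀¹ [ (1/2)·ρ'(x)·log( λ⁺(x)·ρ⁺(x) / (λ⁻(x)·ρ⁻(x)) ) + ρ'(x)·arsinh( ρ'(x) / (2·√(λ⁺(x)·λ⁻(x)·ρ⁺(x)·ρ⁻(x))) ) − √( 4·λ⁺(x)·λ⁻(x)·ρ⁺(x)·ρ⁻(x) + ρ'(x)² ) + λ⁺(x)·ρ⁺(x) + λ⁻(x)·ρ⁻(x) ] dx. -/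
/-- The Hamiltonian density of the zig-zag process, as a function of the log-ratio `w`, with
rates weighted by the densities (`a`, `b`) and density slope `r`. -/
noncomputable def zigzagDensity (a b r w : ℝ) : ℝ :=
  -(w * r) + a * (Real.exp (-w) - 1) + b * (Real.exp w - 1)

/-- The minimizer of `zigzagDensity a b r`. -/
noncomputable def zigzagMinimizer (a b r : ℝ) : ℝ :=
  1 / 2 * Real.log (a / b) + Real.arsinh (r / (2 * Real.sqrt (a * b)))

section Pointwise

variable {a b : ℝ} (r : ℝ)

lemma sqrt_mul_exp_arsinh {q : ℝ} (hq : 0 < q) (r : ℝ) :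
    q * Real.exp (Real.arsinh (r / (2 * q))) = (r + Real.sqrt (4 * q ^ 2 + r ^ 2)) / 2 := by
  have h : 4 * q ^ 2 + r ^ 2 = (2 * q) ^ 2 * (1 + (r / (2 * q)) ^ 2) := by
    field_simp
    ring
  rw [Real.exp_arsinh, h, Real.sqrt_mul (by positivity), Real.sqrt_sq (by positivity)]
  field_simp

lemma exp_half_log_div (ha : 0 < a) (hb : 0 < b) :
    Real.exp (1 / 2 * Real.log (a / b)) = Real.sqrt (a * b) / b := by
  have h : a / b = (a * b) / b ^ 2 := by field_simp
  rw [one_div, inv_mul_eq_div, ← Real.log_sqrt (by positivity),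
    Real.exp_log (by positivity), h, Real.sqrt_div (by positivity), Real.sqrt_sq hb.le]

lemma mul_exp_zigzagMinimizer (ha : 0 < a) (hb : 0 < b) :
    b * Real.exp (zigzagMinimizer a b r) = (r + Real.sqrt (4 * (a * b) + r ^ 2)) / 2 := by
  have hab : 0 < a * b := mul_pos ha hb
  have h := sqrt_mul_exp_arsinh (Real.sqrt_pos.2 hab) r
  rw [Real.sq_sqrt hab.le] at h
  rw [zigzagMinimizer, Real.exp_add, exp_half_log_div ha hb, ← h]
  field_simp

lemma neg_zigzagMinimizer : -zigzagMinimizer a b r = zigzagMinimizer b a (-r) := by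
  rw [zigzagMinimizer, zigzagMinimizer, neg_div, Real.arsinh_neg, mul_comm b a,
    ← inv_div a b, Real.log_inv]
  ring

lemma mul_exp_neg_zigzagMinimizer (ha : 0 < a) (hb : 0 < b) :
    a * Real.exp (-zigzagMinimizer a b r) = (-r + Real.sqrt (4 * (a * b) + r ^ 2)) / 2 := by
  rw [neg_zigzagMinimizer, mul_exp_zigzagMinimizer (-r) hb ha, mul_comm b a, neg_sq]

lemma zigzagDensity_zigzagMinimizer (ha : 0 < a) (hb : 0 < b) :
    zigzagDensity a b r (zigzagMinimizer a b r) =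
      -(zigzagMinimizer a b r * r) + Real.sqrt (4 * (a * b) + r ^ 2) - a - b := by
  have h1 := mul_exp_zigzagMinimizer r ha hb
  have h2 := mul_exp_neg_zigzagMinimizer r ha hb
  rw [zigzagDensity]
  linarith

lemma zigzagDensity_zigzagMinimizer_le (ha : 0 < a) (hb : 0 < b) (w : ℝ) :
    zigzagDensity a b r (zigzagMinimizer a b r) ≤ zigzagDensity a b r w := by
  rw [zigzagDensity_zigzagMinimizer r ha hb, zigzagDensity]
  have h1 := mul_exp_zigzagMinimizer r ha hb
  have h2 := mul_exp_neg_zigzagMinimizer r ha hb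
  set m := zigzagMinimizer a b r
  have e1 : b * Real.exp m * (w - m + 1) ≤ b * Real.exp w := by
    have : Real.exp w = Real.exp m * Real.exp (w - m) := by
      rw [← Real.exp_add]
      ring_nf
    rw [this, ← mul_assoc]
    gcongr
    exact Real.add_one_le_exp _
  have e2 : a * Real.exp (-m) * (-(w - m) + 1) ≤ a * Real.exp (-w) := by
    have : Real.exp (-w) = Real.exp (-m) * Real.exp (-(w - m)) := by
      rw [← Real.exp_add]
      ring_nf
    rw [this, ← mul_assoc]
    gcongr
    exact Real.add_one_le_exp _
  rw [h1] at e1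
  rw [h2] at e2
  linarith

end Pointwise

/-- The average of `w` over the interval from `x` to `x + h`. -/
noncomputable def steklovAverage (w : ℝ → ℝ) (h x : ℝ) : ℝ :=
  ∫ t in (0:ℝ)..1, w (x + h * t)

section Steklov

variable {w : ℝ → ℝ}

lemma steklovAverage_zero (x : ℝ) : steklovAverage w 0 x = w x := by
  simp [steklovAverage]

lemma continuous_steklovAverage (hw : Continuous w) :
    Continuous fun p : ℝ × ℝ => steklovAverage w p.1 p.2 := by
  unfold steklovAverage
  exact intervalIntegral.continuous_parametric_intervalIntegral_of_continuous'
    (f := fun (p : ℝ × ℝ) t => w (p.2 + p.1 * t)) (by fun_prop) 0 1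

lemma Function.Periodic.steklovAverage {c : ℝ} (hw : Function.Periodic w c) (h : ℝ) :
    Function.Periodic (steklovAverage w h) c := by
  intro x
  unfold _root_.steklovAverage
  congr 1
  ext t
  rw [add_right_comm, hw]

lemma contDiff_steklovAverage (hw : Continuous w) {h : ℝ} (hh : h ≠ 0) :
    ContDiff ℝ 1 (steklovAverage w h) := by
  have hP : ContDiff ℝ 1 fun x => ∫ t in (0:ℝ)..x, w t := by
    rw [contDiff_one_iff_deriv]
    refine ⟨fun x => (hw.integral_hasStrictDerivAt 0 x).hasDerivAt.differentiableAt, ?_⟩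
    have : deriv (fun x => ∫ t in (0:ℝ)..x, w t) = w :=
      funext fun x => hw.deriv_integral w 0 x
    rwa [this]
  have : steklovAverage w h =
      fun x => h⁻¹ * ((∫ t in (0:ℝ)..(x + h), w t) - ∫ t in (0:ℝ)..x, w t) := by
    ext x
    rw [steklovAverage, intervalIntegral.integral_comp_add_mul _ hh,
      intervalIntegral.integral_interval_sub_left (hw.intervalIntegrable _ _)
        (hw.intervalIntegrable _ _)]
    simp
  rw [this]
  exact contDiff_const.mul ((hP.comp (contDiff_id.add contDiff_const)).sub hP)

end Steklov

lemma integral_deriv_eq_zero_of_periodic {f f' : ℝ → ℝ} (hf : Function.Periodic f 1)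
    (hd : ∀ x, HasDerivAt f (f' x) x) (hc : Continuous f') :
    ∫ x in (0:ℝ)..1, f' x = 0 := by
  rw [intervalIntegral.integral_eq_sub_of_hasDerivAt (fun x _ => hd x)
    (hc.intervalIntegrable _ _)]
  have := hf 0
  rw [zero_add] at this
  rw [this, sub_self]

lemma zigzag_integral_eq {lp lm ρp ρm up um : ℝ → ℝ}
    (hlp : Continuous lp) (hlm : Continuous lm)
    (hρp : ContDiff ℝ 1 ρp) (hρm : ContDiff ℝ 1 ρm)
    (hρpper : Function.Periodic ρp 1) (hρmper : Function.Periodic ρm 1)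
    (hderiv : ∀ x, deriv ρp x = deriv ρm x)
    (hup : ContDiff ℝ 1 up) (hum : ContDiff ℝ 1 um)
    (hupper : Function.Periodic up 1) (humper : Function.Periodic um 1)
    (hup0 : ∀ x, 0 < up x) (hum0 : ∀ x, 0 < um x) :
    ∫ x in (0:ℝ)..1,
        ((deriv up x / up x + lp x * (um x / up x - 1)) * ρp x
          + (-(deriv um x) / um x + lm x * (up x / um x - 1)) * ρm x) =
      ∫ x in (0:ℝ)..1, zigzagDensity (lp x * ρp x) (lm x * ρm x) (deriv ρp x)
        (Real.log (up x) - Real.log (um x)) := by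
  have hup' := fun x => (hup0 x).ne'
  have hum' := fun x => (hum0 x).ne'
  have cup := hup.continuous
  have cum := hum.continuous
  have cρp := hρp.continuous
  have cρm := hρm.continuous
  have dup := hup.continuous_deriv_one
  have dum := hum.continuous_deriv_one
  have dρp := hρp.continuous_deriv_one
  have dρm := hρm.continuous_deriv_one
  have hlogup : Continuous fun x => Real.log (up x) := cup.log hup'
  have hlogum : Continuous fun x => Real.log (um x) := cum.log hum'
  have hzero := integral_deriv_eq_zero_of_periodic
    (f := fun x => Real.log (up x) * ρp x - Real.log (um x) * ρm x)
    (f' := fun x => (deriv up x / up x * ρp x + Real.log (up x) * deriv ρp x)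
      - (deriv um x / um x * ρm x + Real.log (um x) * deriv ρm x))
    (fun x => by simp only [hupper x, humper x, hρpper x, hρmper x])
    (fun x => (((hup.differentiable one_ne_zero x).hasDerivAt.log (hup' x)).mul
      (hρp.differentiable one_ne_zero x).hasDerivAt).sub
      (((hum.differentiable one_ne_zero x).hasDerivAt.log (hum' x)).mul
      (hρm.differentiable one_ne_zero x).hasDerivAt))
    (by fun_prop (disch := assumption))
  rw [← sub_eq_zero, ← intervalIntegral.integral_sub, ← hzero]
  · congr 1
    ext x
    have e1 : Real.exp (Real.log (up x) - Real.log (um x)) = up x / um x := by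
      rw [Real.exp_sub, Real.exp_log (hup0 x), Real.exp_log (hum0 x)]
    have e2 : Real.exp (-(Real.log (up x) - Real.log (um x))) = um x / up x := by
      rw [neg_sub, Real.exp_sub, Real.exp_log (hup0 x), Real.exp_log (hum0 x)]
    rw [zigzagDensity, e1, e2, ← hderiv x]
    ring
  · refine Continuous.intervalIntegrable ?_ _ _
    fun_prop (disch := assumption)
  · refine Continuous.intervalIntegrable ?_ _ _
    unfold zigzagDensity
    fun_prop (disch := assumption)

/-- Proposition 3.5 of the paper, first case: the explicit expression for the
Donsker–Varadhan rate function of the zig-zag process on the torus. When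
`(ρ⁺)' = (ρ⁻)'` and all densities are strictly positive, minus the infimum of
`H(u⁺,u⁻) = ∫₀¹ [(u⁺'/u⁺ + λ⁺(u⁻/u⁺ - 1))ρ⁺ + (-u⁻'/u⁻ + λ⁻(u⁺/u⁻ - 1))ρ⁻] dx`
over pairs of continuously differentiable, 1-periodic, positive functions equals
`∫₀¹ [ (1/2)ρ'·log(λ⁺ρ⁺/(λ⁻ρ⁻)) + ρ'·arsinh(ρ'/(2√(λ⁺λ⁻ρ⁺ρ⁻)))
      - √(4λ⁺λ⁻ρ⁺ρ⁻ + (ρ')²) + λ⁺ρ⁺ + λ⁻ρ⁻ ] dx`. -/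
theorem zigzag_rate_explicit (lp lm ρp ρm : ℝ → ℝ)
    (hlpc : Continuous lp) (hlmc : Continuous lm)
    (hlp0 : ∀ x, 0 < lp x) (hlm0 : ∀ x, 0 < lm x)
    (hlpper : Function.Periodic lp 1) (hlmper : Function.Periodic lm 1)
    (hρp : ContDiff ℝ 1 ρp) (hρm : ContDiff ℝ 1 ρm)
    (hρpper : Function.Periodic ρp 1) (hρmper : Function.Periodic ρm 1)
    (hρp0 : ∀ x, 0 < ρp x) (hρm0 : ∀ x, 0 < ρm x)
    (hderiv : ∀ x, deriv ρp x = deriv ρm x)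
    (H : (ℝ → ℝ) → (ℝ → ℝ) → ℝ)
    (hH : ∀ up um : ℝ → ℝ, H up um =
      ∫ x in (0:ℝ)..1,
        ((deriv up x / up x + lp x * (um x / up x - 1)) * ρp x
          + (-(deriv um x) / um x + lm x * (up x / um x - 1)) * ρm x)) :
    -sInf {y : ℝ | ∃ up um : ℝ → ℝ,
        ContDiff ℝ 1 up ∧ ContDiff ℝ 1 um ∧
        Function.Periodic up 1 ∧ Function.Periodic um 1 ∧
        (∀ x, 0 < up x) ∧ (∀ x, 0 < um x) ∧ H up um = y} =
      ∫ x in (0:ℝ)..1,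
        ((1 / 2) * deriv ρp x * Real.log (lp x * ρp x / (lm x * ρm x))
          + deriv ρp x *
              Real.arsinh (deriv ρp x / (2 * Real.sqrt (lp x * lm x * ρp x * ρm x)))
          - Real.sqrt (4 * lp x * lm x * ρp x * ρm x + (deriv ρp x) ^ 2)
          + lp x * ρp x + lm x * ρm x) := by
  have cρp := hρp.continuous
  have cρm := hρm.continuous
  have dρp := hρp.continuous_deriv_one
  have hap : ∀ x, 0 < lp x * ρp x := fun x => mul_pos (hlp0 x) (hρp0 x)
  have hbp : ∀ x, 0 < lm x * ρm x := fun x => mul_pos (hlm0 x) (hρm0 x)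
  set m : ℝ → ℝ := fun x => zigzagMinimizer (lp x * ρp x) (lm x * ρm x) (deriv ρp x) with hm
  have hmc : Continuous m := by
    have h1 : Continuous fun x => Real.log (lp x * ρp x / (lm x * ρm x)) :=
      ((hlpc.mul cρp).div (hlmc.mul cρm) fun x => (hbp x).ne').log
        fun x => (div_pos (hap x) (hbp x)).ne'
    have h2 : Continuous fun x =>
        deriv ρp x / (2 * Real.sqrt (lp x * ρp x * (lm x * ρm x))) :=
      dρp.div (by fun_prop) fun x =>
        (mul_pos two_pos (Real.sqrt_pos.2 (mul_pos (hap x) (hbp x)))).ne'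
    exact (continuous_const.mul h1).add (Real.continuous_arsinh.comp h2)
  have hmper : Function.Periodic m 1 := by
    intro x
    have hd : deriv ρp (x + 1) = deriv ρp x := by
      rw [← deriv_comp_add_const, show (fun y => ρp (y + 1)) = ρp from funext hρpper]
    simp only [hm, hd, hlpper x, hlmper x, hρpper x, hρmper x]
  set F : (ℝ → ℝ) → ℝ → ℝ := fun w x =>
    zigzagDensity (lp x * ρp x) (lm x * ρm x) (deriv ρp x) (w x) with hF
  have hFc : ∀ w, Continuous w → Continuous (F w) := by
    intro w hw
    simp only [hF, zigzagDensity]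
    fun_prop
  have hvalue : ∫ x in (0:ℝ)..1, F m x = -∫ x in (0:ℝ)..1,
        ((1 / 2) * deriv ρp x * Real.log (lp x * ρp x / (lm x * ρm x))
          + deriv ρp x *
              Real.arsinh (deriv ρp x / (2 * Real.sqrt (lp x * lm x * ρp x * ρm x)))
          - Real.sqrt (4 * lp x * lm x * ρp x * ρm x + (deriv ρp x) ^ 2)
          + lp x * ρp x + lm x * ρm x) := by
    rw [← intervalIntegral.integral_neg]
    congr 1
    ext x
    simp only [hF, hm]
    rw [zigzagDensity_zigzagMinimizer _ (hap x) (hbp x), zigzagMinimizer,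
      show lp x * ρp x * (lm x * ρm x) = lp x * lm x * ρp x * ρm x by ring,
      show 4 * (lp x * lm x * ρp x * ρm x) = 4 * lp x * lm x * ρp x * ρm x by ring]
    ring
  rw [neg_eq_iff_eq_neg, ← hvalue]
  have hHF : ∀ up um : ℝ → ℝ, ContDiff ℝ 1 up → ContDiff ℝ 1 um →
      Function.Periodic up 1 → Function.Periodic um 1 → (∀ x, 0 < up x) → (∀ x, 0 < um x) →
      H up um = ∫ x in (0:ℝ)..1, F (fun x => Real.log (up x) - Real.log (um x)) x := by
    intro up um hup hum hupper humper hup0 hum0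
    rw [hH, zigzag_integral_eq hlpc hlmc hρp hρm hρpper hρmper hderiv hup hum hupper humper
      hup0 hum0]
  have happrox : ∀ h : ℝ, h ≠ 0 → (∫ x in (0:ℝ)..1, F (steklovAverage m h) x) ∈
      {y : ℝ | ∃ up um : ℝ → ℝ,
        ContDiff ℝ 1 up ∧ ContDiff ℝ 1 um ∧
        Function.Periodic up 1 ∧ Function.Periodic um 1 ∧
        (∀ x, 0 < up x) ∧ (∀ x, 0 < um x) ∧ H up um = y} := by
    intro h hh
    have h1 : ContDiff ℝ 1 fun x => Real.exp (steklovAverage m h x) :=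
      (contDiff_steklovAverage hmc hh).exp
    have h2 : Function.Periodic (fun x => Real.exp (steklovAverage m h x)) 1 := fun x => by
      simp only [hmper.steklovAverage h x]
    refine ⟨fun x => Real.exp (steklovAverage m h x), fun _ => 1, h1, contDiff_const, h2,
      fun _ => rfl, fun _ => Real.exp_pos _, fun _ => one_pos, ?_⟩
    rw [hHF _ _ h1 contDiff_const h2 (fun _ => rfl) (fun _ => Real.exp_pos _)
      fun _ => one_pos]
    simp
  refine (isGLB_of_mem_closure ?_ ?_).csInf_eq ⟨_, happrox 1 one_ne_zero⟩
  · rintro _ ⟨up, um, hup, hum, hupper, humper, hup0, hum0, rfl⟩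
    rw [hHF up um hup hum hupper humper hup0 hum0]
    refine intervalIntegral.integral_mono_on zero_le_one
      ((hFc m hmc).intervalIntegrable _ _) ((hFc _ ?_).intervalIntegrable _ _)
      fun x _ => zigzagDensity_zigzagMinimizer_le _ (hap x) (hbp x) _
    exact (hup.continuous.log fun x => (hup0 x).ne').sub
      (hum.continuous.log fun x => (hum0 x).ne')
  · have hcont : Continuous fun h : ℝ => ∫ x in (0:ℝ)..1, F (steklovAverage m h) x := by
      have hS := continuous_steklovAverage hmc
      refine intervalIntegral.continuous_parametric_intervalIntegral_of_continuous' ?_ 0 1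
      simp only [hF, zigzagDensity, Function.uncurry_def]
      fun_prop
    have hlim := hcont.tendsto 0
    rw [show steklovAverage m 0 = m from funext steklovAverage_zero] at hlim
    exact mem_closure_of_tendsto (hlim.mono_left nhdsWithin_le_nhds)
      (Filter.Eventually.mono (self_mem_nhdsWithin (s := ({0}ᶜ : Set ℝ))) happrox)
end

section
/- Let λ⁺, λ⁻ : ℝ → (0, ∞) be continuous 1-periodic functions, and let ρ⁺ ≥ 0 and ρ⁻ ≥ 0 be constants. Then −inf of H(u⁺, u⁻) over all pairs of continuously differentiable 1-periodic functions u⁺, u⁻ : ℝ → (0, ∞) equals ∫₀¹ ( √(λ⁺(x)·ρ⁺) − √(λ⁻(x)·ρ⁻) )² dx, where here H is evaluated with the constant densities ρ⁺(x) ≡ ρ⁺ and ρ⁻(x) ≡ ρ⁻. -/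
theorem uniformContinuous_of_periodic {f : ℝ → ℝ} (hf : Continuous f)
    (hper : Function.Periodic f 1) : UniformContinuous f := by
  have hlift : Continuous (hper.lift : UnitAddCircle → ℝ) := continuous_coinduced_dom.mpr hf
  exact (CompactSpace.uniformContinuous_of_continuous hlift).comp
    (uniformContinuous_addMonoidHom_of_continuous
      (f := QuotientAddGroup.mk' (AddSubgroup.zmultiples (1 : ℝ))) (AddCircle.continuous_mk' 1))

/-- A continuous `1`-periodic function is a uniform limit of `C¹` `1`-periodic functions. -/
theorem exists_contDiff_one_periodic_abs_sub_le {f : ℝ → ℝ} (hf : Continuous f)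
    (hper : Function.Periodic f 1) {ε : ℝ} (hε : 0 < ε) :
    ∃ g : ℝ → ℝ, ContDiff ℝ 1 g ∧ Function.Periodic g 1 ∧ ∀ x, |g x - f x| ≤ ε := by
  obtain ⟨δ, hδ, hfδ⟩ :=
    Metric.uniformContinuous_iff.1 (uniformContinuous_of_periodic hf hper) ε hε
  set h := δ / 2 with hh
  have hh0 : 0 < h := by positivity
  have hshift : ∀ x, ∫ t in (0:ℝ)..h, f (x + t) = ∫ t in x..x + h, f t := fun x => by
    simp [intervalIntegral.integral_comp_add_left]
  refine ⟨fun x => h⁻¹ * ∫ t in (0:ℝ)..h, f (x + t), ?_, ?_, ?_⟩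
  · have hF : ∀ x, HasDerivAt (fun y => ∫ t in (0:ℝ)..y, f t) (f x) x := fun x =>
      hf.integral_hasStrictDerivAt 0 x |>.hasDerivAt
    have hF1 : ContDiff ℝ 1 (fun y => ∫ t in (0:ℝ)..y, f t) := by
      rw [contDiff_one_iff_deriv]
      refine ⟨fun x => (hF x).differentiableAt, ?_⟩
      rwa [funext fun x => (hF x).deriv]
    have heq : (fun x => h⁻¹ * ∫ t in (0:ℝ)..h, f (x + t)) =
        fun x => h⁻¹ * ((∫ t in (0:ℝ)..(x + h), f t) - ∫ t in (0:ℝ)..x, f t) := by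
      funext x
      rw [hshift, intervalIntegral.integral_interval_sub_left
        (hf.intervalIntegrable _ _) (hf.intervalIntegrable _ _)]
    rw [heq]
    exact contDiff_const.mul ((hF1.comp (contDiff_id.add contDiff_const)).sub hF1)
  · intro x
    have : ∀ t, f (x + 1 + t) = f (x + t) := fun t => by
      rw [add_right_comm]; exact hper _
    simp only [this]
  · intro x
    have hc : Continuous fun t => f (x + t) := by fun_prop
    have hsub : (∫ t in (0:ℝ)..h, f (x + t)) - h * f x = ∫ t in (0:ℝ)..h, (f (x + t) - f x) := by
      rw [intervalIntegral.integral_sub (hc.intervalIntegrable _ _) (by simp)]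
      simp
    have hbound : |∫ t in (0:ℝ)..h, (f (x + t) - f x)| ≤ ε * |h - 0| := by
      rw [← Real.norm_eq_abs]
      refine intervalIntegral.norm_integral_le_of_norm_le_const fun t ht => ?_
      rw [Set.uIoc_of_le hh0.le] at ht
      refine (hfδ ?_).le
      rw [Real.dist_eq, add_sub_cancel_left, abs_of_pos ht.1]
      linarith [ht.2]
    rw [← hsub, sub_zero, abs_of_pos hh0] at hbound
    have : h⁻¹ * (∫ t in (0:ℝ)..h, f (x + t)) - f x =
        h⁻¹ * ((∫ t in (0:ℝ)..h, f (x + t)) - h * f x) := by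
      field_simp
    rw [this, abs_mul, abs_of_pos (inv_pos.2 hh0), inv_mul_le_iff₀ hh0, mul_comm h ε]
    exact hbound

/-- The logarithmic derivative of a positive periodic function has integral zero. -/
theorem integral_logDeriv_eq_zero_of_periodic {u : ℝ → ℝ} (hu : ContDiff ℝ 1 u)
    (hper : Function.Periodic u 1) (hpos : ∀ x, 0 < u x) :
    ∫ x in (0:ℝ)..1, deriv u x / u x = 0 := by
  have hderiv : ∀ x, HasDerivAt (fun y => Real.log (u y)) (deriv u x / u x) x := fun x =>
    ((hu.differentiable one_ne_zero x).hasDerivAt).log (hpos x).ne'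
  have hcont : Continuous fun x => deriv u x / u x :=
    (hu.continuous_deriv le_rfl).div hu.continuous fun x => (hpos x).ne'
  rw [intervalIntegral.integral_eq_sub_of_hasDerivAt (fun x _ => hderiv x)
    (hcont.intervalIntegrable _ _), hper.eq, sub_self]

/-- For constant densities the transport terms of the Donsker–Varadhan functional integrate to
zero. -/
theorem integral_zigzag_eq_integral_jump {lp lm up um : ℝ → ℝ} (ρp ρm : ℝ)
    (hlpc : Continuous lp) (hlmc : Continuous lm)
    (hup : ContDiff ℝ 1 up) (hum : ContDiff ℝ 1 um)
    (hupper : Function.Periodic up 1) (humper : Function.Periodic um 1)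
    (hup0 : ∀ x, 0 < up x) (hum0 : ∀ x, 0 < um x) :
    ∫ x in (0:ℝ)..1,
        ((deriv up x / up x + lp x * (um x / up x - 1)) * ρp
          + (-(deriv um x) / um x + lm x * (up x / um x - 1)) * ρm) =
      ∫ x in (0:ℝ)..1, (lp x * ρp * (um x / up x - 1) + lm x * ρm * (up x / um x - 1)) := by
  have hupc := hup.continuous
  have humc := hum.continuous
  have hup1 : ∀ x, up x ≠ 0 := fun x => (hup0 x).ne'
  have hum1 : ∀ x, um x ≠ 0 := fun x => (hum0 x).ne'
  have hdp : Continuous fun x => deriv up x / up x := (hup.continuous_deriv le_rfl).div hupc hup1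
  have hdm : Continuous fun x => deriv um x / um x := (hum.continuous_deriv le_rfl).div humc hum1
  have hjump : Continuous fun x =>
      lp x * ρp * (um x / up x - 1) + lm x * ρm * (up x / um x - 1) := by
    fun_prop (disch := assumption)
  have hsplit : ∀ x, (deriv up x / up x + lp x * (um x / up x - 1)) * ρp
        + (-(deriv um x) / um x + lm x * (up x / um x - 1)) * ρm =
      (ρp * (deriv up x / up x) - ρm * (deriv um x / um x)) +
        (lp x * ρp * (um x / up x - 1) + lm x * ρm * (up x / um x - 1)) := fun x => by ring
  simp only [hsplit]
  have htransport : Continuous fun x =>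
      ρp * (deriv up x / up x) - ρm * (deriv um x / um x) :=
    (hdp.const_mul ρp).sub (hdm.const_mul ρm)
  rw [intervalIntegral.integral_add (htransport.intervalIntegrable _ _)
      (hjump.intervalIntegrable _ _),
    intervalIntegral.integral_sub ((hdp.const_mul ρp).intervalIntegrable _ _)
      ((hdm.const_mul ρm).intervalIntegrable _ _),
    intervalIntegral.integral_const_mul, intervalIntegral.integral_const_mul,
    integral_logDeriv_eq_zero_of_periodic hup hupper hup0,
    integral_logDeriv_eq_zero_of_periodic hum humper hum0]
  simp

theorem neg_sq_sqrt_sub_sqrt_le {a b w : ℝ} (ha : 0 ≤ a) (hb : 0 ≤ b) (hw : 0 < w) :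
    -(√a - √b) ^ 2 ≤ a * (w - 1) + b * (w⁻¹ - 1) := by
  have hs : √w * (√w)⁻¹ = 1 := mul_inv_cancel₀ (Real.sqrt_pos.2 hw).ne'
  have hinv : (√w)⁻¹ ^ 2 = w⁻¹ := by rw [inv_pow, Real.sq_sqrt hw.le]
  have key : (√a * √w - √b * (√w)⁻¹) ^ 2 = a * w + b * w⁻¹ - 2 * √a * √b := by
    calc _ = √a ^ 2 * √w ^ 2 + √b ^ 2 * (√w)⁻¹ ^ 2 - 2 * √a * √b * (√w * (√w)⁻¹) := by ring
      _ = _ := by rw [hs, hinv, Real.sq_sqrt ha, Real.sq_sqrt hb, Real.sq_sqrt hw.le, mul_one]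
  nlinarith [sq_nonneg (√a * √w - √b * (√w)⁻¹), Real.sq_sqrt ha, Real.sq_sqrt hb]

/-- Choosing `w` within a factor `exp s` of `√((b + s) / (a + s))` nearly minimises the jump
cost `a * (w - 1) + b * (w⁻¹ - 1)`. -/
theorem jump_exp_le {a b s g : ℝ} (ha : 0 ≤ a) (hb : 0 ≤ b) (hs : 0 < s)
    (hg : |g - Real.log √((b + s) / (a + s))| ≤ s) :
    a * (Real.exp g - 1) + b * ((Real.exp g)⁻¹ - 1) ≤
      Real.exp s * (2 * (√(a + s) * √(b + s))) - a - b := by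
  have hp : 0 < √(a + s) := Real.sqrt_pos.2 (by linarith)
  have hq : 0 < √(b + s) := Real.sqrt_pos.2 (by linarith)
  have hp2 : √(a + s) ^ 2 = a + s := Real.sq_sqrt (by linarith)
  have hq2 : √(b + s) ^ 2 = b + s := Real.sq_sqrt (by linarith)
  rw [Real.sqrt_div (by linarith)] at hg
  obtain ⟨hg1, hg2⟩ := abs_le.1 hg
  have h1 : Real.exp g ≤ Real.exp s * (√(b + s) / √(a + s)) := by
    rw [← Real.exp_log (div_pos hq hp), ← Real.exp_add, Real.exp_le_exp]
    linarith
  have h2 : (Real.exp g)⁻¹ ≤ Real.exp s * (√(a + s) / √(b + s)) := by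
    rw [← inv_div √(b + s), ← Real.exp_log (div_pos hq hp), ← Real.exp_neg, ← Real.exp_neg,
      ← Real.exp_add, Real.exp_le_exp]
    linarith
  have h3 : a * Real.exp g ≤ Real.exp s * (√(a + s) * √(b + s)) :=
    calc a * Real.exp g ≤ √(a + s) ^ 2 * (Real.exp s * (√(b + s) / √(a + s))) := by
          rw [hp2]
          exact mul_le_mul (by linarith) h1 (Real.exp_pos _).le (by linarith)
      _ = _ := by field_simp
  have h4 : b * (Real.exp g)⁻¹ ≤ Real.exp s * (√(a + s) * √(b + s)) :=
    calc b * (Real.exp g)⁻¹ ≤ √(b + s) ^ 2 * (Real.exp s * (√(a + s) / √(b + s))) := by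
          rw [hq2]
          exact mul_le_mul (by linarith) h2 (inv_pos.2 (Real.exp_pos _)).le (by linarith)
      _ = _ := by field_simp
  linarith


/-- Proposition 3.5 of the paper, constant-density case (equation (3.4)): for constant
densities `ρ⁺, ρ⁻ ≥ 0`, minus the infimum of the Donsker–Varadhan functional
`H(u⁺,u⁻) = ∫₀¹ [(u⁺'/u⁺ + λ⁺(u⁻/u⁺ - 1))ρ⁺ + (-u⁻'/u⁻ + λ⁻(u⁺/u⁻ - 1))ρ⁻] dx`
over pairs of continuously differentiable, 1-periodic, positive functions equals
`∫₀¹ (√(λ⁺ρ⁺) - √(λ⁻ρ⁻))² dx`. -/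
theorem zigzag_rate_explicit_constant (lp lm : ℝ → ℝ) (ρp ρm : ℝ)
    (hlpc : Continuous lp) (hlmc : Continuous lm)
    (hlp0 : ∀ x, 0 < lp x) (hlm0 : ∀ x, 0 < lm x)
    (hlpper : Function.Periodic lp 1) (hlmper : Function.Periodic lm 1)
    (hρp0 : 0 ≤ ρp) (hρm0 : 0 ≤ ρm)
    (H : (ℝ → ℝ) → (ℝ → ℝ) → ℝ)
    (hH : ∀ up um : ℝ → ℝ, H up um =
      ∫ x in (0:ℝ)..1,
        ((deriv up x / up x + lp x * (um x / up x - 1)) * ρp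
          + (-(deriv um x) / um x + lm x * (up x / um x - 1)) * ρm)) :
    -sInf {y : ℝ | ∃ up um : ℝ → ℝ,
        ContDiff ℝ 1 up ∧ ContDiff ℝ 1 um ∧
        Function.Periodic up 1 ∧ Function.Periodic um 1 ∧
        (∀ x, 0 < up x) ∧ (∀ x, 0 < um x) ∧ H up um = y} =
      ∫ x in (0:ℝ)..1,
        (Real.sqrt (lp x * ρp) - Real.sqrt (lm x * ρm)) ^ 2 := by
  have hlpρ : ∀ x, 0 ≤ lp x * ρp := fun x => mul_nonneg (hlp0 x).le hρp0
  have hlmρ : ∀ x, 0 ≤ lm x * ρm := fun x => mul_nonneg (hlm0 x).le hρm0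
  set F : ℝ → ℝ := fun s => ∫ x in (0:ℝ)..1,
    (Real.exp s * (2 * (√(lp x * ρp + s) * √(lm x * ρm + s))) - lp x * ρp - lm x * ρm) with hF
  have hFc : Continuous F := by
    refine intervalIntegral.continuous_parametric_intervalIntegral_of_continuous' ?_ 0 1
    fun_prop
  have hF0 : F 0 = -∫ x in (0:ℝ)..1, (√(lp x * ρp) - √(lm x * ρm)) ^ 2 := by
    rw [← intervalIntegral.integral_neg]
    refine intervalIntegral.integral_congr fun x _ => ?_
    simp only [Real.exp_zero, add_zero]
    linear_combination Real.sq_sqrt (hlpρ x) + Real.sq_sqrt (hlmρ x)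
  rw [neg_eq_iff_eq_neg, ← hF0]
  refine IsGLB.csInf_eq ⟨?_, fun c hc => ?_⟩ ⟨_, fun _ => 1, fun _ => 1, contDiff_const,
    contDiff_const, fun _ => rfl, fun _ => rfl, fun _ => one_pos, fun _ => one_pos, rfl⟩
  · rintro _ ⟨up, um, hup, hum, hupper, humper, hup0, hum0, rfl⟩
    have hup1 : ∀ x, up x ≠ 0 := fun x => (hup0 x).ne'
    have hum1 : ∀ x, um x ≠ 0 := fun x => (hum0 x).ne'
    have hupc := hup.continuous
    have humc := hum.continuous
    rw [hH, hF0, integral_zigzag_eq_integral_jump ρp ρm hlpc hlmc hup hum hupper humper hup0 hum0,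
      ← intervalIntegral.integral_neg]
    refine intervalIntegral.integral_mono_on zero_le_one
      (Continuous.intervalIntegrable (by fun_prop) _ _)
      (Continuous.intervalIntegrable (by fun_prop (disch := assumption)) _ _) fun x _ => ?_
    rw [← inv_div (um x)]
    exact neg_sq_sqrt_sub_sqrt_le (hlpρ x) (hlmρ x) (div_pos (hum0 x) (hup0 x))
  · have hle : ∀ s, 0 < s → c ≤ F s := fun s hs => by
      have hp : ∀ x, 0 < lp x * ρp + s := fun x => by linarith [hlpρ x]
      have hm : ∀ x, 0 < lm x * ρm + s := fun x => by linarith [hlmρ x]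
      have hlog : Continuous fun x => Real.log √((lm x * ρm + s) / (lp x * ρp + s)) := by
        refine Continuous.log (Continuous.sqrt (Continuous.div (by fun_prop) (by fun_prop)
          fun x => (hp x).ne')) fun x => (Real.sqrt_pos.2 (div_pos (hm x) (hp x))).ne'
      obtain ⟨g, hg, hgper, hgs⟩ := exists_contDiff_one_periodic_abs_sub_le hlog
        (fun x => by simp only [hlpper x, hlmper x]) hs
      have hgc := hg.continuous
      have hexp : ∀ x, Real.exp (g x) ≠ 0 := fun x => (Real.exp_pos _).ne'
      have hexpper : Function.Periodic (fun x => Real.exp (g x)) 1 := fun x => by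
        simp only [hgper x]
      refine (hc ⟨fun _ => 1, fun x => Real.exp (g x), contDiff_const, hg.exp, fun _ => rfl,
        hexpper, fun _ => one_pos, fun _ => Real.exp_pos _, rfl⟩).trans ?_
      rw [hH, integral_zigzag_eq_integral_jump ρp ρm hlpc hlmc contDiff_const hg.exp
        (fun _ => rfl) hexpper (fun _ => one_pos) (fun _ => Real.exp_pos _)]
      refine intervalIntegral.integral_mono_on zero_le_one
        (Continuous.intervalIntegrable (by fun_prop (disch := assumption)) _ _)
        (Continuous.intervalIntegrable (by fun_prop) _ _) fun x _ => ?_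
      rw [div_one, one_div]
      exact jump_exp_le (hlpρ x) (hlmρ x) hs (hgs x)
    exact ge_of_tendsto (hFc.continuousWithinAt (s := Set.Ioi 0) (x := 0)).tendsto
      (Filter.eventually_of_mem self_mem_nhdsWithin hle)
end

section
/- Let λ⁺, λ⁻ : ℝ → (0, ∞) be continuous 1-periodic functions with ∫₀¹ (λ⁺(x) − λ⁻(x)) dx = 0, and let ρ : ℝ → (0, ∞) be a continuously differentiable 1-periodic function. Let k = inf over x of ρ(x). For c ∈ (−k, k), define 𝓘(c) = ∫₀¹ [ (1/2)·ρ'(x)·log( λ⁺(x)·(ρ(x)+c) / (λ⁻(x)·(ρ(x)−c)) ) + ρ'(x)·arsinh( ρ'(x) / (2·√(λ⁺(x)·λ⁻(x)·(ρ(x)+c)·(ρ(x)−c))) ) − √( 4·λ⁺(x)·λ⁻(x)·(ρ(x)² − c²) + ρ'(x)² ) + λ⁺(x)·(ρ(x)+c) + λ⁻(x)·(ρ(x)−c) ] dx. Then 𝓘(c) ≥ 𝓘(0) for all c ∈ (−k, k), i.e. c ↦ 𝓘(c) is minimized at c = 0. -/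
open intervalIntegral in
/-- For a periodic `C¹` function `ρ` staying above `|c|`, the integral over a period of
`ρ' (log (ρ + c) - log (ρ - c))` vanishes, the integrand being the derivative of a periodic
function. -/
theorem integral_deriv_mul_log_sub_log_eq_zero {ρ : ℝ → ℝ} (hρ : ContDiff ℝ 1 ρ)
    (hper : Function.Periodic ρ 1) {c : ℝ} (hc : ∀ x, |c| < ρ x) :
    ∫ x in (0 : ℝ)..1, deriv ρ x * (Real.log (ρ x + c) - Real.log (ρ x - c)) = 0 := by
  have hadd : ∀ x, ρ x + c ≠ 0 := fun x => by linarith [(abs_lt.1 (hc x)).1] |> ne_of_gt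
  have hsub : ∀ x, ρ x - c ≠ 0 := fun x => by linarith [(abs_lt.1 (hc x)).2] |> ne_of_gt
  have hρc : Continuous ρ := hρ.continuous
  have hρ'c : Continuous (deriv ρ) := hρ.continuous_deriv le_rfl
  have hderiv : ∀ x, HasDerivAt (fun y => ((ρ y + c) * Real.log (ρ y + c) - (ρ y + c)) -
      ((ρ y - c) * Real.log (ρ y - c) - (ρ y - c)))
      (deriv ρ x * (Real.log (ρ x + c) - Real.log (ρ x - c))) x := by
    intro x
    have h : HasDerivAt ρ (deriv ρ x) x := (hρ.differentiable one_ne_zero x).hasDerivAt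
    have h1 := h.add_const c
    have h2 := h.sub_const c
    refine (((h1.mul (h1.log (hadd x))).sub h1).sub
      ((h2.mul (h2.log (hsub x))).sub h2)).congr_deriv ?_
    rw [mul_div_cancel₀ _ (hadd x), mul_div_cancel₀ _ (hsub x)]
    ring
  rw [integral_eq_sub_of_hasDerivAt (fun x _ => hderiv x)
    (Continuous.intervalIntegrable (hρ'c.mul (((hρc.add continuous_const).log hadd).sub
      ((hρc.sub continuous_const).log hsub))) _ _)]
  have h01 : ρ 1 = ρ 0 := by simpa using hper 0
  simp [h01]

/-- The map `a ↦ p * arsinh (p / a)` is antitone on the positive half-line. -/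
theorem mul_arsinh_div_le_mul_arsinh_div (p : ℝ) {a b : ℝ} (ha : 0 < a) (hab : a ≤ b) :
    p * Real.arsinh (p / b) ≤ p * Real.arsinh (p / a) := by
  rcases le_total 0 p with hp | hp
  · exact mul_le_mul_of_nonneg_left
      (Real.arsinh_le_arsinh.2 (div_le_div_of_nonneg_left hp ha hab)) hp
  · refine mul_le_mul_of_nonpos_left (Real.arsinh_le_arsinh.2 ?_) hp
    rw [div_le_div_iff₀ ha (ha.trans_le hab)]
    exact mul_le_mul_of_nonpos_left hab hp


/-- Proposition 3.6 of the paper: the explicit zig-zag rate function (equation (3.3)),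
evaluated at the measure with densities `ρ(x,±1) = ρ(x) ± c`, is minimized over the
velocity-asymmetry parameter `c ∈ (-k, k)` (where `k = inf ρ`) at `c = 0`. -/
theorem zigzag_rate_minimized_at_zero_asymmetry (lp lm ρ : ℝ → ℝ)
    (hlpc : Continuous lp) (hlmc : Continuous lm)
    (hlp0 : ∀ x, 0 < lp x) (hlm0 : ∀ x, 0 < lm x)
    (hlpper : Function.Periodic lp 1) (hlmper : Function.Periodic lm 1)
    (hint : (∫ x in (0:ℝ)..1, (lp x - lm x)) = 0)
    (hρ : ContDiff ℝ 1 ρ) (hρper : Function.Periodic ρ 1) (hρ0 : ∀ x, 0 < ρ x)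
    (k : ℝ) (hk : k = ⨅ x : ℝ, ρ x)
    (I : ℝ → ℝ)
    (hI : ∀ c, I c =
      ∫ x in (0:ℝ)..1,
        ((1 / 2) * deriv ρ x * Real.log (lp x * (ρ x + c) / (lm x * (ρ x - c)))
          + deriv ρ x *
              Real.arsinh (deriv ρ x /
                (2 * Real.sqrt (lp x * lm x * (ρ x + c) * (ρ x - c))))
          - Real.sqrt (4 * lp x * lm x * (ρ x ^ 2 - c ^ 2) + (deriv ρ x) ^ 2)
          + lp x * (ρ x + c) + lm x * (ρ x - c))) :
    ∀ c : ℝ, |c| < k → I 0 ≤ I c := by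
  intro c hck
  have hkρ : ∀ x, k ≤ ρ x := fun x => hk ▸ ciInf_le ⟨0, by rintro _ ⟨y, rfl⟩; exact (hρ0 y).le⟩ x
  have hρc : Continuous ρ := hρ.continuous
  have hρ'c : Continuous (deriv ρ) := hρ.continuous_deriv le_rfl
  set g : ℝ → ℝ → ℝ := fun c x =>
    (1 / 2) * deriv ρ x * (Real.log (lp x) - Real.log (lm x))
      + deriv ρ x * Real.arsinh (deriv ρ x /
          (2 * Real.sqrt (lp x * lm x * (ρ x + c) * (ρ x - c))))
      - Real.sqrt (4 * lp x * lm x * (ρ x ^ 2 - c ^ 2) + (deriv ρ x) ^ 2)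
      + (lp x + lm x) * ρ x with hg
  have hpos : ∀ c, |c| < k → ∀ x, 0 < ρ x + c ∧ 0 < ρ x - c := by
    intro c hc x
    have := hkρ x
    have := abs_lt.1 hc
    constructor <;> linarith
  have hsq : ∀ c, |c| < k → ∀ x, 0 < 2 * Real.sqrt (lp x * lm x * (ρ x + c) * (ρ x - c)) := by
    intro c hc x
    have := hpos c hc x
    have := hlp0 x
    have := hlm0 x
    have : 0 < lp x * lm x * (ρ x + c) * (ρ x - c) := by
      apply mul_pos (mul_pos (mul_pos _ _) _) <;> tauto
    positivity
  have hgc : ∀ c, |c| < k → IntervalIntegrable (g c) MeasureTheory.volume 0 1 := by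
    intro c hc
    apply Continuous.intervalIntegrable
    have h1 := hlpc.log fun x => (hlp0 x).ne'
    have h2 := hlmc.log fun x => (hlm0 x).ne'
    have h3 : Continuous fun x => deriv ρ x /
        (2 * Real.sqrt (lp x * lm x * (ρ x + c) * (ρ x - c))) :=
      hρ'c.div (by fun_prop) fun x => (hsq c hc x).ne'
    have h4 := Real.continuous_arsinh.comp h3
    simp only [Function.comp_def] at h4
    simp only [hg]
    fun_prop
  have hIg : ∀ c, |c| < k → I c = ∫ x in (0 : ℝ)..1, g c x := by
    intro c hc
    have hlog : Continuous fun x =>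
        deriv ρ x * (Real.log (ρ x + c) - Real.log (ρ x - c)) :=
      hρ'c.mul (((hρc.add continuous_const).log fun x => (hpos c hc x).1.ne').sub
        ((hρc.sub continuous_const).log fun x => (hpos c hc x).2.ne'))
    have hrew : I c = ∫ x in (0 : ℝ)..1, (g c x
        + (1 / 2) * (deriv ρ x * (Real.log (ρ x + c) - Real.log (ρ x - c)))
        + c * (lp x - lm x)) := by
      rw [hI]
      congr 1
      ext x
      have ⟨h1, h2⟩ := hpos c hc x
      have h3 := hlp0 x
      have h4 := hlm0 x
      rw [Real.log_div (mul_pos h3 h1).ne' (mul_pos h4 h2).ne', Real.log_mul h3.ne' h1.ne',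
        Real.log_mul h4.ne' h2.ne']
      simp only [hg]
      ring
    have hlogI : IntervalIntegrable (fun x =>
        (1 / 2) * (deriv ρ x * (Real.log (ρ x + c) - Real.log (ρ x - c))))
        MeasureTheory.volume 0 1 := (hlog.const_mul _).intervalIntegrable _ _
    rw [hrew, intervalIntegral.integral_add ((hgc c hc).add hlogI)
        (Continuous.intervalIntegrable (by fun_prop) _ _),
      intervalIntegral.integral_add (hgc c hc) hlogI,
      intervalIntegral.integral_const_mul, intervalIntegral.integral_const_mul, hint,
      integral_deriv_mul_log_sub_log_eq_zero hρ hρper fun x => hc.trans_le (hkρ x)]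
    ring
  have h0k : |(0 : ℝ)| < k := by simpa using (abs_nonneg c).trans_lt hck
  rw [hIg 0 h0k, hIg c hck]
  refine intervalIntegral.integral_mono_on zero_le_one (hgc 0 h0k) (hgc c hck) fun x _ => ?_
  have hll : 0 < lp x * lm x := mul_pos (hlp0 x) (hlm0 x)
  have hllc : 0 ≤ lp x * lm x * c ^ 2 := by positivity
  have harsinh := mul_arsinh_div_le_mul_arsinh_div (deriv ρ x) (hsq c hck x)
    (b := 2 * Real.sqrt (lp x * lm x * (ρ x + 0) * (ρ x - 0)))
    (mul_le_mul_of_nonneg_left (Real.sqrt_le_sqrt (by linarith)) zero_le_two)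
  have hsqrt : Real.sqrt (4 * lp x * lm x * (ρ x ^ 2 - c ^ 2) + (deriv ρ x) ^ 2) ≤
      Real.sqrt (4 * lp x * lm x * (ρ x ^ 2 - 0 ^ 2) + (deriv ρ x) ^ 2) :=
    Real.sqrt_le_sqrt (by linarith)
  simp only [hg]
  exact add_le_add_left (sub_le_sub (add_le_add_right harsinh _) hsqrt) _
end

section
/- Let U : ℝ → ℝ be twice continuously differentiable with U'(x) → +∞ as x → +∞, U'(x) → −∞ as x → −∞, and U''(x)/U'(x) → 0 as |x| → ∞. Then for every α ∈ (0, 1), every β > 0, and every v ∈ {−1, +1}, the function x ↦ α·v·U'(x) + β·U''(x) + max(v·U'(x), 0)·(exp(−2·v·β·U'(x)) − 1) tends to −∞ as x → +∞ and as x → −∞. -/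
open Filter

/-- If `w → ∞` and `q / w → 0`, the switching term dominates the drift `α * w + β * q`. -/
lemma tendsto_drift_add_switching_of_atTop {ι : Type*} {l : Filter ι} {w q : ι → ℝ} {α β : ℝ}
    (hα : α < 1) (hβ : 0 < β) (hw : Tendsto w l atTop)
    (hq : Tendsto (fun x => q x / w x) l (nhds 0)) :
    Tendsto (fun x => α * w x + β * q x + max (w x) 0 * (Real.exp (-2 * β * w x) - 1))
      l atBot := by
  have hexp : Tendsto (fun x => Real.exp (-2 * β * w x)) l (nhds 0) :=
    Real.tendsto_exp_atBot.comp (hw.const_mul_atTop_of_neg (by linarith))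
  have hfactor : Tendsto (fun x => α + β * (q x / w x) + (Real.exp (-2 * β * w x) - 1)) l
      (nhds (α - 1)) := by
    convert ((hq.const_mul β).const_add α).add (hexp.sub_const 1) using 2
    ring
  refine (hw.atTop_mul_neg (by linarith) hfactor).congr' ?_
  filter_upwards [hw.eventually_gt_atTop 0] with x hx
  rw [max_eq_left hx.le]
  field_simp

/-- If `w → -∞` and `q / w → 0`, the switching term vanishes and the drift `α * w + β * q`
tends to `-∞`. -/
lemma tendsto_drift_add_switching_of_atBot {ι : Type*} {l : Filter ι} {w q : ι → ℝ} {α β : ℝ}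
    (hα : 0 < α) (hw : Tendsto w l atBot)
    (hq : Tendsto (fun x => q x / w x) l (nhds 0)) :
    Tendsto (fun x => α * w x + β * q x + max (w x) 0 * (Real.exp (-2 * β * w x) - 1))
      l atBot := by
  have hfactor : Tendsto (fun x => α + β * (q x / w x)) l (nhds α) := by
    simpa using (hq.const_mul β).const_add α
  refine (hw.atBot_mul_pos hα hfactor).congr' ?_
  filter_upwards [hw.eventually_lt_atBot 0] with x hx
  have hx0 : w x ≠ 0 := hx.ne
  rw [max_eq_right hx.le]
  field_simp
  ring

/-- Lyapunov function computation in the proof of Theorem 3.4 of the paper, verifying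
Condition (A.4) for `g₂(x,v) = α·U(x) + β·v·U'(x)`: the function
`x ↦ α·v·U'(x) + β·U''(x) + max(v·U'(x), 0)·(exp(-2vβU'(x)) - 1)`
(which equals `e^{-g₂}·B e^{g₂}`) tends to `-∞` as `x → +∞` and as `x → -∞`. -/
theorem zigzag_lyapunov_g2 (U : ℝ → ℝ) (hU : ContDiff ℝ 2 U)
    (hU'top : Tendsto (deriv U) atTop atTop)
    (hU'bot : Tendsto (deriv U) atBot atBot)
    (hU''top : Tendsto (fun x => deriv (deriv U) x / deriv U x) atTop (nhds 0))
    (hU''bot : Tendsto (fun x => deriv (deriv U) x / deriv U x) atBot (nhds 0))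
    (α β : ℝ) (hα : 0 < α) (hα1 : α < 1) (hβ : 0 < β)
    (v : ℝ) (hv : v = 1 ∨ v = -1) :
    Tendsto (fun x => α * v * deriv U x + β * deriv (deriv U) x
        + max (v * deriv U x) 0 * (Real.exp (-2 * v * β * deriv U x) - 1))
      atTop atBot ∧
    Tendsto (fun x => α * v * deriv U x + β * deriv (deriv U) x
        + max (v * deriv U x) 0 * (Real.exp (-2 * v * β * deriv U x) - 1))
      atBot atBot := by
  rcases hv with rfl | rfl
  · constructor
    · simpa using tendsto_drift_add_switching_of_atTop hα1 hβ hU'top hU''top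
    · simpa using tendsto_drift_add_switching_of_atBot (β := β) hα hU'bot hU''bot
  · have hneg {l : Filter ℝ} (h : Tendsto (fun x => deriv (deriv U) x / deriv U x) l (nhds 0)) :
        Tendsto (fun x => deriv (deriv U) x / -deriv U x) l (nhds 0) := by
      simpa [div_neg] using h.neg
    constructor
    · simpa using tendsto_drift_add_switching_of_atBot (β := β) hα
        (tendsto_neg_atTop_atBot.comp hU'top) (hneg hU''top)
    · simpa using tendsto_drift_add_switching_of_atTop hα1 hβ
        (tendsto_neg_atBot_atTop.comp hU'bot) (hneg hU''bot)
end

section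
/- Let U, V : ℝ → ℝ be twice continuously differentiable such that U'(x) → +∞ as x → +∞ and U'(x) → −∞ as x → −∞; U''(x)/U'(x) → 0 as |x| → ∞; V'(x) → +∞ as x → +∞ and V'(x) → −∞ as x → −∞; V'(x)/U'(x) → 0 as |x| → ∞; and U''(x)/V'(x) → 0 as |x| → ∞. Then for every α ∈ (0, 1), every β > 0, and every v ∈ {−1, +1}, the function x ↦ α·v·V'(x) + β·U''(x) + max(v·U'(x), 0)·(exp(−2·v·β·U'(x)) − 1) tends to −∞ as x → +∞ and as x → −∞. -/
open Filter

/-- The common core of both limits, with `p = U'`, `q = V'`, `r = U''` along an arbitrary filter. -/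
theorem tendsto_lyapunov_atBot {ι : Type*} {l : Filter ι} {p q r : ι → ℝ} {α β v : ℝ}
    (hp : Tendsto p l atTop) (hq : Tendsto q l atTop)
    (hqp : Tendsto (fun x => q x / p x) l (nhds 0))
    (hrq : Tendsto (fun x => r x / q x) l (nhds 0))
    (hα : 0 < α) (hα1 : α < 1) (hβ : 0 < β) (hv : v = 1 ∨ v = -1) :
    Tendsto (fun x => α * v * q x + β * r x
        + max (v * p x) 0 * (Real.exp (-2 * v * β * p x) - 1)) l atBot := by
  have hexp : Tendsto (fun x => Real.exp (-(2 * β * p x))) l (nhds 0) :=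
    Real.tendsto_exp_neg_atTop_nhds_zero.comp (hp.const_mul_atTop (by positivity))
  have hbound : Tendsto (fun x => -(α / 2 * q x)) l atBot :=
    tendsto_neg_atTop_atBot.comp (hq.const_mul_atTop (by positivity))
  refine tendsto_atBot_mono' l ?_ hbound
  filter_upwards [hp.eventually_gt_atTop 0, hq.eventually_gt_atTop 0,
    hqp.eventually_lt_const (show (0 : ℝ) < 1 / 8 by norm_num),
    hrq.eventually_lt_const (show 0 < α / (2 * β) by positivity),
    hexp.eventually_lt_const (show (0 : ℝ) < 1 / 2 by norm_num)] with x hpx hqx hqpx hrqx hex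
  rw [div_lt_iff₀ hpx] at hqpx
  rw [div_lt_iff₀ hqx] at hrqx
  have hr : β * r x ≤ α / 2 * q x := by
    calc β * r x ≤ β * (α / (2 * β) * q x) := by gcongr
      _ = α / 2 * q x := by field_simp
  rcases hv with rfl | rfl
  · have hmax : max (1 * p x) 0 = p x := by rw [one_mul, max_eq_left hpx.le]
    have harg : -2 * 1 * β * p x = -(2 * β * p x) := by ring
    rw [hmax, harg]
    have hjump : p x * (Real.exp (-(2 * β * p x)) - 1) ≤ p x * (-1 / 2) := by
      gcongr
      linarith
    have hαq : α * q x ≤ q x := mul_le_of_le_one_left hqx.le hα1.le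
    linarith
  · have hmax : max (-1 * p x) 0 = 0 := max_eq_right (by linarith)
    rw [hmax]
    linarith

/-- Lyapunov function computation in the proof of Theorem 3.4 of the paper, verifying
Condition (A.4) for `g₁(x,v) = α·V(x) + β·v·U'(x)` under Assumptions (B.1)–(B.3) and
(C.1)–(C.3): the function
`x ↦ α·v·V'(x) + β·U''(x) + max(v·U'(x), 0)·(exp(-2vβU'(x)) - 1)`
(which equals `e^{-g₁}·B e^{g₁}`) tends to `-∞` as `x → +∞` and as `x → -∞`. -/
theorem zigzag_lyapunov_g1 (U V : ℝ → ℝ) (hU : ContDiff ℝ 2 U) (hV : ContDiff ℝ 2 V)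
    (hU'top : Tendsto (deriv U) atTop atTop)
    (hU'bot : Tendsto (deriv U) atBot atBot)
    (hU''U'top : Tendsto (fun x => deriv (deriv U) x / deriv U x) atTop (nhds 0))
    (hU''U'bot : Tendsto (fun x => deriv (deriv U) x / deriv U x) atBot (nhds 0))
    (hV'top : Tendsto (deriv V) atTop atTop)
    (hV'bot : Tendsto (deriv V) atBot atBot)
    (hV'U'top : Tendsto (fun x => deriv V x / deriv U x) atTop (nhds 0))
    (hV'U'bot : Tendsto (fun x => deriv V x / deriv U x) atBot (nhds 0))
    (hU''V'top : Tendsto (fun x => deriv (deriv U) x / deriv V x) atTop (nhds 0))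
    (hU''V'bot : Tendsto (fun x => deriv (deriv U) x / deriv V x) atBot (nhds 0))
    (α β : ℝ) (hα : 0 < α) (hα1 : α < 1) (hβ : 0 < β)
    (v : ℝ) (hv : v = 1 ∨ v = -1) :
    Tendsto (fun x => α * v * deriv V x + β * deriv (deriv U) x
        + max (v * deriv U x) 0 * (Real.exp (-2 * v * β * deriv U x) - 1))
      atTop atBot ∧
    Tendsto (fun x => α * v * deriv V x + β * deriv (deriv U) x
        + max (v * deriv U x) 0 * (Real.exp (-2 * v * β * deriv U x) - 1))
      atBot atBot := by
  refine ⟨tendsto_lyapunov_atBot hU'top hV'top hV'U'top hU''V'top hα hα1 hβ hv, ?_⟩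
  have h := tendsto_lyapunov_atBot (p := fun x => -deriv U x) (q := fun x => -deriv V x)
    (r := deriv (deriv U)) (v := -v)
    (tendsto_neg_atBot_atTop.comp hU'bot) (tendsto_neg_atBot_atTop.comp hV'bot)
    (by simpa only [neg_div_neg_eq] using hV'U'bot)
    (by simpa only [div_neg, neg_zero] using hU''V'bot.neg)
    hα hα1 hβ (by rcases hv with rfl | rfl <;> simp)
  simpa only [mul_neg, neg_mul, neg_neg] using h
end

section
/- Let u, w ∈ ℝ with u ≠ 0, w ≠ 0 and u·w > 0 (so that w/u > 0). For γ > 0 set λ⁺(γ) = γ + max(u, 0) and λ⁻(γ) = γ + max(−u, 0). Then, as γ → 0⁺, −(w/2)·log(λ⁺(γ)/λ⁻(γ)) + w·arsinh( w/(2·√(λ⁺(γ)·λ⁻(γ))) ) − √(4·λ⁺(γ)·λ⁻(γ) + w²) + λ⁺(γ) + λ⁻(γ) converges to |w|·( log(w/u) − 1 ) + |u|. -/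
open Filter

/-- For positive `a`, `b`, the logarithm and `arsinh` terms combine into one logarithm. -/
theorem neg_half_mul_log_div_add_mul_arsinh {a b : ℝ} (w : ℝ) (ha : 0 < a) (hb : 0 < b) :
    -(w / 2) * Real.log (a / b) + w * Real.arsinh (w / (2 * Real.sqrt (a * b)))
      = w * Real.log ((w + Real.sqrt (4 * a * b + w ^ 2)) / (2 * a)) := by
  have hab : 0 < a * b := mul_pos ha hb
  have hs : 0 < Real.sqrt (a * b) := Real.sqrt_pos.2 hab
  have hsq : Real.sqrt (a * b) ^ 2 = a * b := Real.sq_sqrt hab.le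
  have hroot : Real.sqrt (1 + (w / (2 * Real.sqrt (a * b))) ^ 2)
      = Real.sqrt (4 * a * b + w ^ 2) / (2 * Real.sqrt (a * b)) := by
    rw [show 1 + (w / (2 * Real.sqrt (a * b))) ^ 2
        = (4 * a * b + w ^ 2) / (2 * Real.sqrt (a * b)) ^ 2 by
      field_simp
      rw [hsq]
      ring, Real.sqrt_div' _ (sq_nonneg _), Real.sqrt_sq (by positivity)]
  have hpos : 0 < w + Real.sqrt (4 * a * b + w ^ 2) := by
    have h := Real.sqrt_lt_sqrt (sq_nonneg w) (show w ^ 2 < 4 * a * b + w ^ 2 by linarith)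
    rw [Real.sqrt_sq_eq_abs] at h
    linarith [neg_abs_le w]
  rw [Real.arsinh, hroot, ← add_div, Real.log_div hpos.ne' (by positivity),
    Real.log_div hpos.ne' (by positivity), Real.log_div ha.ne' hb.ne',
    Real.log_mul two_ne_zero hs.ne', Real.log_mul two_ne_zero ha.ne', Real.log_sqrt hab.le,
    Real.log_mul ha.ne' hb.ne']
  ring

/-- The limit of the zig-zag integrand when the canonical rate and `w` are both positive. -/
theorem tendsto_zigzag_integrand_of_pos {u w : ℝ} (hu : 0 < u) (hw : 0 < w) :
    Tendsto
      (fun γ : ℝ =>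
        -(w / 2) * Real.log ((γ + u) / γ)
          + w * Real.arsinh (w / (2 * Real.sqrt ((γ + u) * γ)))
          - Real.sqrt (4 * (γ + u) * γ + w ^ 2) + (γ + u) + γ)
      (nhdsWithin 0 (Set.Ioi 0))
      (nhds (w * (Real.log (w / u) - 1) + u)) := by
  have hcont : ContinuousAt (fun γ : ℝ =>
      w * Real.log ((w + Real.sqrt (4 * (γ + u) * γ + w ^ 2)) / (2 * (γ + u)))
        - Real.sqrt (4 * (γ + u) * γ + w ^ 2) + (γ + u) + γ) 0 := by
    have hsqrt : ContinuousAt (fun γ : ℝ => Real.sqrt (4 * (γ + u) * γ + w ^ 2)) 0 := by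
      fun_prop
    have hden : ContinuousAt (fun γ : ℝ => 2 * (γ + u)) 0 := by fun_prop
    have hquot := (continuousAt_const (y := w)).add hsqrt |>.div hden (by simp [hu.ne'])
    have hlog := hquot.log (by
      have h : 0 < (w + Real.sqrt (4 * (0 + u) * 0 + w ^ 2)) / (2 * (0 + u)) := by
        rw [zero_add]
        positivity
      exact h.ne')
    exact (((continuousAt_const.mul hlog).sub hsqrt).add (by fun_prop)).add continuousAt_id
  have hlim := hcont.tendsto.mono_left (nhdsWithin_le_nhds (s := Set.Ioi 0))
  have hval : w * Real.log ((w + Real.sqrt (4 * (0 + u) * 0 + w ^ 2)) / (2 * (0 + u)))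
        - Real.sqrt (4 * (0 + u) * 0 + w ^ 2) + (0 + u) + 0
      = w * (Real.log (w / u) - 1) + u := by
    rw [mul_zero, zero_add, zero_add, Real.sqrt_sq hw.le, ← two_mul,
      mul_div_mul_left _ _ two_ne_zero]
    ring
  rw [hval] at hlim
  refine hlim.congr' ?_
  filter_upwards [self_mem_nhdsWithin] with γ hγ
  have hγ : 0 < γ := hγ
  rw [neg_half_mul_log_div_add_mul_arsinh w (add_pos hγ hu) hγ]

/-- Pointwise limit yielding the γ ↓ 0 expression (3.8) of the paper: with
`λ⁺(γ) = γ + max(u,0)`, `λ⁻(γ) = γ + max(-u,0)` and `u·w > 0`, the integrand of the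
explicit zig-zag rate function converges, as `γ → 0⁺`, to
`|w|·(log(w/u) - 1) + |u|`. -/
theorem zigzag_rate_integrand_gamma_limit (u w : ℝ) (hu : u ≠ 0) (hw : w ≠ 0)
    (huw : 0 < u * w) :
    Tendsto
      (fun γ : ℝ =>
        -(w / 2) * Real.log ((γ + max u 0) / (γ + max (-u) 0))
          + w * Real.arsinh (w / (2 * Real.sqrt ((γ + max u 0) * (γ + max (-u) 0))))
          - Real.sqrt (4 * (γ + max u 0) * (γ + max (-u) 0) + w ^ 2)
          + (γ + max u 0) + (γ + max (-u) 0))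
      (nhdsWithin 0 (Set.Ioi 0))
      (nhds (|w| * (Real.log (w / u) - 1) + |u|)) := by
  rcases pos_and_pos_or_neg_and_neg_of_mul_pos huw with ⟨hu0, hw0⟩ | ⟨hu0, hw0⟩
  · simpa only [max_eq_left hu0.le, max_eq_right (neg_nonpos.2 hu0.le), add_zero,
      abs_of_pos hu0, abs_of_pos hw0] using tendsto_zigzag_integrand_of_pos hu0 hw0
  · have h := tendsto_zigzag_integrand_of_pos (neg_pos.2 hu0) (neg_pos.2 hw0)
    rw [neg_div_neg_eq] at h
    rw [abs_of_neg hu0, abs_of_neg hw0]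
    refine h.congr fun γ => ?_
    rw [max_eq_right hu0.le, max_eq_left (neg_nonneg.2 hu0.le), add_zero, neg_div (2 * _) w,
      Real.arsinh_neg, neg_sq, mul_comm (γ + -u) γ, mul_right_comm 4 (γ + -u) γ,
      ← inv_div γ (γ + -u), Real.log_inv]
    ring
end
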